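/- Under Assumptions 1–4, there exists ε₀ > 0 such that for every ε ∈ (0, ε₀) the slow–fast system ẋ = f(x,y,z), ẏ = g(x,y,z), ε ż = x + |z| has a non-constant periodic solution; moreover, these periodic solutions can be chosen so that their minimal periods T_min(ε) tend to σ − τ as ε → 0. -/

import Mathlib

section

open Set Filter Topology

namespace Canard

/-- Continuous logarithm of a nonvanishing planar map on the plane. -/
lemma exists_log (F : ℝ × ℝ → ℂ) (hF : Continuous F) (h0 : ∀ p, F p ≠ 0) :
    ∃ G : ℝ × ℝ → ℂ, Continuous G ∧ ∀ p, Complex.exp (G p) = F p := by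
  obtain ⟨G, hG, -⟩ := Complex.isCoveringMapOn_exp.existsUnique_continuousMap_lifts
    (A := ℝ × ℝ) ⟨F, hF⟩ (a₀ := 0) (e₀ := Complex.log (F 0))
    (by simp [Complex.exp_log (h0 0)]) (by intro a; simpa using h0 a)
  exact ⟨G, G.continuous, fun p => congrFun hG.2 p⟩

/-- a real function on a segment avoiding a value stays on one side. -/
lemma avoid_lt {φ : ℝ → ℝ} (hφ : Continuous φ) {a b c : ℝ}
    (hne : ∀ t ∈ uIcc a b, φ t ≠ c) (ha : φ a < c) : φ b < c := by
  by_contra hb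
  push Not at hb
  have := intermediate_value_uIcc (f := φ) (a := a) (b := b) hφ.continuousOn
  have hc : c ∈ uIcc (φ a) (φ b) := by
    rw [uIcc_of_le (ha.le.trans hb)]; exact ⟨ha.le, hb⟩
  obtain ⟨t, ht, h⟩ := this hc
  exact hne t ht h

lemma avoid_gt {φ : ℝ → ℝ} (hφ : Continuous φ) {a b c : ℝ}
    (hne : ∀ t ∈ uIcc a b, φ t ≠ c) (ha : c < φ a) : c < φ b := by
  have := avoid_lt (φ := fun t => - φ t) hφ.neg (a := a) (b := b) (c := -c)
    (fun t ht h => hne t ht (by simpa using h)) (by simpa using ha)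
  simpa using this

/-- A planar zero-existence lemma (Poincaré–Miranda type), by continuous logarithms. -/
lemma exists_zero_square (F₁ F₂ : ℝ × ℝ → ℝ) (h₁ : Continuous F₁) (h₂ : Continuous F₂)
    {d : ℝ} (hd : 0 < d)
    (right : ∀ v ∈ Icc (-d) d, 0 < F₂ (d, v))
    (top : ∀ u ∈ Icc (-d) d, 0 < F₂ (u, d))
    (bottom : ∀ u ∈ Icc (-d) d, F₁ (u, -d) = 0 → F₂ (u, -d) < 0)
    (left : ∀ v ∈ Icc (-d) d, F₁ (-d, v) = 0 → F₂ (-d, v) < 0)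
    (hA : 0 < F₁ (d, -d)) (hC : F₁ (-d, d) < 0) :
    ∃ p, F₁ p = 0 ∧ F₂ p = 0 := by
  by_contra hno
  push Not at hno
  obtain ⟨G, hG, hexp⟩ := exists_log (fun p => ⟨F₁ p, F₂ p⟩)
    (by
      have : (fun p => (⟨F₁ p, F₂ p⟩ : ℂ)) = fun p => (F₁ p : ℂ) + F₂ p * Complex.I := by
        ext p; apply Complex.ext <;> simp
      rw [this]; fun_prop)
    (by
      intro p hp
      have hre := congrArg Complex.re hp
      have him := congrArg Complex.im hp
      exact hno p hre him)
  have hre : ∀ p, F₁ p = Real.exp (G p).re * Real.cos (G p).im := fun p => by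
    have := congrArg Complex.re (hexp p); rw [Complex.exp_re] at this; exact this.symm
  have him : ∀ p, F₂ p = Real.exp (G p).re * Real.sin (G p).im := fun p => by
    have := congrArg Complex.im (hexp p); rw [Complex.exp_im] at this; exact this.symm
  set k : ℤ := ⌊(G (d, -d)).im / (2 * Real.pi)⌋ with hk
  set θ : ℝ × ℝ → ℝ := fun p => (G p).im - k * (2 * Real.pi) with hθ
  have hθc : Continuous θ := by
    have := Complex.continuous_im.comp hG
    simp only [hθ]; fun_prop
  have hcos : ∀ p, F₁ p = Real.exp (G p).re * Real.cos (θ p) := fun p => by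
    rw [hre, hθ]; simp only [Real.cos_sub_int_mul_two_pi]
  have hsin : ∀ p, F₂ p = Real.exp (G p).re * Real.sin (θ p) := fun p => by
    rw [him, hθ]; simp only [Real.sin_sub_int_mul_two_pi]
  have hpi := Real.pi_pos
  have hA0 : 0 ≤ θ (d, -d) := by
    have := Int.floor_le ((G (d, -d)).im / (2 * Real.pi))
    rw [le_div_iff₀ (by positivity)] at this
    simp only [hθ]; linarith
  have hA1 : θ (d, -d) < 2 * Real.pi := by
    have := Int.lt_floor_add_one ((G (d, -d)).im / (2 * Real.pi))
    rw [div_lt_iff₀ (by positivity)] at this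
    simp only [hθ]; linarith
  have hsgn : ∀ p, 0 < F₂ p → 0 < Real.sin (θ p) := fun p hp => by
    rw [hsin] at hp; exact (pos_iff_pos_of_mul_pos hp).1 (Real.exp_pos _)
  have hmem : ∀ {t : ℝ}, t ∈ uIcc (-d) d → t ∈ Icc (-d) d := fun {t} ht => by
    rwa [uIcc_of_le (by linarith)] at ht
  have hmem' : ∀ {t : ℝ}, t ∈ uIcc d (-d) → t ∈ Icc (-d) d := fun {t} ht => by
    rw [uIcc_comm] at ht; exact hmem ht
  have dmem : d ∈ Icc (-d) d := ⟨by linarith, le_rfl⟩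
  have ndmem : -d ∈ Icc (-d) d := ⟨le_rfl, by linarith⟩
  have sA := hsgn _ (right (-d) ndmem)
  have hApos : 0 < θ (d, -d) := by
    rcases hA0.lt_or_eq with h | h
    · exact h
    · rw [← h] at sA; simp at sA
  have hApi : θ (d, -d) < Real.pi := by
    by_contra h
    push Not at h
    have : Real.sin (θ (d, -d)) ≤ 0 := by
      have h1 := Real.sin_nonneg_of_nonneg_of_le_pi (x := θ (d, -d) - Real.pi)
        (by linarith) (by linarith)
      rw [Real.sin_sub_pi] at h1; linarith
    linarith
  have hA2 : θ (d, -d) < Real.pi / 2 := by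
    by_contra h
    push Not at h
    have := Real.cos_nonpos_of_pi_div_two_le_of_le h (by linarith)
    rw [hcos] at hA
    have := (pos_iff_pos_of_mul_pos hA).1 (Real.exp_pos _)
    linarith
  -- right side
  have r0 : ∀ v ∈ Icc (-d) d, θ (d, v) ≠ 0 ∧ θ (d, v) ≠ Real.pi := fun v hv => by
    have := hsgn _ (right v hv)
    constructor <;> intro h <;> rw [h] at this <;> simp at this
  have t0 : ∀ u ∈ Icc (-d) d, θ (u, d) ≠ 0 ∧ θ (u, d) ≠ Real.pi := fun v hv => by
    have := hsgn _ (top v hv)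
    constructor <;> intro h <;> rw [h] at this <;> simp at this
  have cR : Continuous fun v => θ (d, v) := by fun_prop
  have cT : Continuous fun u => θ (u, d) := by fun_prop
  have cB : Continuous fun u => θ (u, -d) := by fun_prop
  have cL : Continuous fun v => θ (-d, v) := by fun_prop
  have hB1 := avoid_gt cR (fun t ht => (r0 t (hmem ht)).1) hApos
  have hB2 := avoid_lt cR (fun t ht => (r0 t (hmem ht)).2) hApi
  have hC1 := avoid_gt cT (fun t ht => (t0 t (hmem' ht)).1) hB1
  have hC2 := avoid_lt cT (fun t ht => (t0 t (hmem' ht)).2) hB2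
  have hC3 : Real.pi / 2 < θ (-d, d) := by
    by_contra h
    push Not at h
    have := Real.cos_nonneg_of_neg_pi_div_two_le_of_le (x := θ (-d, d)) (by linarith) h
    rw [hcos] at hC
    have := mul_nonneg (Real.exp_pos (G (-d, d)).re).le this
    linarith
  have key : ∀ p, (F₁ p = 0 → F₂ p < 0) → θ p ≠ Real.pi / 2 := fun p hp h => by
    have h1 : F₁ p = 0 := by rw [hcos, h]; simp
    have h2 := hp h1
    rw [hsin, h, Real.sin_pi_div_two] at h2
    have := Real.exp_pos (G p).re
    linarith
  have hD1 := avoid_lt cB (fun t ht => key _ (bottom t (hmem' ht))) hA2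
  have hD2 := avoid_gt cL (fun t ht => key _ (left t (hmem' ht))) hC3
  linarith

/-- First exit. -/
lemma first_exit {φ φ' : ℝ → ℝ} {a b : ℝ} (hab : a ≤ b)
    (hd : ∀ t, HasDerivAt φ (φ' t) t) (ha : φ a ≤ 0) (hb : 0 < φ b) :
    ∃ t ∈ Ico a b, (∀ s ∈ Icc a t, φ s ≤ 0) ∧ φ t = 0 ∧ 0 ≤ φ' t := by
  have hc : Continuous φ := continuous_iff_continuousAt.2 fun t => (hd t).continuousAt
  set S : Set ℝ := {s | s ∈ Icc a b ∧ 0 < φ s} with hS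
  have hSne : S.Nonempty := ⟨b, ⟨hab, le_rfl⟩, hb⟩
  have hSb : BddBelow S := ⟨a, fun s hs => hs.1.1⟩
  set t := sInf S with ht
  have hat : a ≤ t := le_csInf hSne fun s hs => hs.1.1
  have htb : t ≤ b := csInf_le hSb ⟨⟨hab, le_rfl⟩, hb⟩
  have hlt : ∀ s ∈ Ico a t, φ s ≤ 0 := fun s hs => by
    by_contra h
    push Not at h
    have := csInf_le hSb (show s ∈ S from ⟨⟨hs.1, hs.2.le.trans htb⟩, h⟩)
    exact absurd hs.2 (not_lt.2 this)
  have hle : φ t ≤ 0 := by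
    rcases hat.eq_or_lt with h | h
    · rw [← h]; exact ha
    · have hcl : t ∈ closure (Ico a t) := by
        rw [closure_Ico h.ne]; exact ⟨hat, le_rfl⟩
      exact (isClosed_le hc continuous_const).closure_subset_iff.2 (fun s hs => hlt s hs) hcl
  have hge : 0 ≤ φ t := by
    have hcl : t ∈ closure S := csInf_mem_closure hSne hSb
    exact (isClosed_le continuous_const hc).closure_subset_iff.2 (fun s hs => hs.2.le) hcl
  have h0 : φ t = 0 := le_antisymm hle hge
  have htb' : t < b := lt_of_le_of_ne htb fun h => by rw [← h, h0] at hb; exact lt_irrefl _ hb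
  refine ⟨t, ⟨hat, htb'⟩, fun s hs => ?_, h0, ?_⟩
  · rcases hs.2.eq_or_lt with h | h
    · rw [h]; exact hle
    · exact hlt s ⟨hs.1, h⟩
  · by_contra hneg
    push Not at hneg
    have hev : ∀ᶠ s in 𝓝[>] t, φ s < 0 := by
      have h1 := (hasDerivAt_iff_tendsto_slope.1 (hd t)).mono_left
        (nhdsWithin_mono t (show Ioi t ⊆ {t}ᶜ from fun s hs => ne_of_gt hs))
      have h2 := h1.eventually (gt_mem_nhds hneg)
      filter_upwards [h2, self_mem_nhdsWithin] with s hs hst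
      rw [slope_def_field, h0, sub_zero, div_neg_iff] at hs
      have hst' : t < s := hst
      rcases hs with h | h
      · linarith [h.2]
      · exact h.1
    obtain ⟨c, hc1, hc2⟩ := (mem_nhdsGT_iff_exists_Ioo_subset).1 hev
    have : ∃ s ∈ S, s < c := by
      by_contra hno
      push Not at hno
      have := le_csInf hSne hno
      exact absurd hc1 (not_lt.2 this)
    obtain ⟨s, hs, hsc⟩ := this
    have hts : t ≤ s := csInf_le hSb hs
    have hts' : t < s := lt_of_le_of_ne hts fun h => by
      have := hs.2; rw [← h, h0] at this; exact lt_irrefl _ this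
    have := hc2 ⟨hts', hsc⟩
    exact absurd hs.2 (not_lt.2 (le_of_lt this))

end Canard
end

section

open Set Filter Topology

namespace Canard

set_option linter.unusedSectionVars false

lemma integral_exp_abs_bound {c : ℝ} (hc : 0 < c) (t : ℝ) :
    |∫ s in (0:ℝ)..t, Real.exp (c * |s|)| ≤ Real.exp (c * |t|) / c := by
  have key : ∀ t : ℝ, 0 ≤ t → (∫ s in (0:ℝ)..t, Real.exp (c * |s|)) = (Real.exp (c * t) - 1) / c := by
    intro t ht
    have h1 : (∫ s in (0:ℝ)..t, Real.exp (c * |s|)) = ∫ s in (0:ℝ)..t, Real.exp (c * s) := by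
      apply intervalIntegral.integral_congr
      intro s hs
      rw [uIcc_of_le ht] at hs
      simp only [abs_of_nonneg hs.1]
    rw [h1, intervalIntegral.integral_comp_mul_left (fun s => Real.exp s) hc.ne', integral_exp]
    simp; field_simp
  have bound : ∀ t : ℝ, 0 ≤ t → |(Real.exp (c * t) - 1) / c| ≤ Real.exp (c * t) / c := by
    intro t ht
    have : 1 ≤ Real.exp (c * t) := Real.one_le_exp (by positivity)
    rw [abs_of_nonneg (div_nonneg (by linarith) hc.le)]
    gcongr; linarith
  rcases le_total 0 t with h | h
  · rw [key t h, abs_of_nonneg h]; exact bound t h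
  · have h2 : (∫ s in (0:ℝ)..t, Real.exp (c * |s|)) = - ∫ s in (0:ℝ)..(-t), Real.exp (c * |s|) := by
      have := intervalIntegral.integral_comp_neg (a := 0) (b := t) (fun s => Real.exp (c * |s|))
      simp only [abs_neg, neg_zero] at this
      rw [this, intervalIntegral.integral_symm]
    rw [h2, abs_neg, key (-t) (by linarith), abs_of_nonpos h]
    exact bound (-t) (by linarith)

variable {E : Type*} [NormedAddCommGroup E] [NormedSpace ℝ E] [CompleteSpace E]

/-- Global existence for globally Lipschitz autonomous ODE. -/
lemma exists_global (v : E → E) (K : NNReal) (hv : LipschitzWith K v) (x₀ : E) :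
    ∃ x : ℝ → E, x 0 = x₀ ∧ ∀ t, HasDerivAt x (v (x t)) t := by
  set c : ℝ := 2 * K + 1 with hcdef
  have hc : 0 < c := by positivity
  have hK : (K : ℝ) / c ≤ 1 / 2 := by rw [div_le_iff₀ hc]; simp [hcdef]; linarith
  set w : ℝ → ℝ := fun s => Real.exp (c * |s|) with hw
  have hwc : Continuous w := by fun_prop
  have hwpos : ∀ s, 0 < w s := fun s => Real.exp_pos _
  have hw1 : ∀ s, 1 ≤ w s := fun s => Real.one_le_exp (by positivity)
  have hbint : ∀ (t C : ℝ) (h : ℝ → E), 0 ≤ C → Continuous h → (∀ s, ‖h s‖ ≤ C * w s) →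
      ‖∫ s in (0:ℝ)..t, h s‖ ≤ C * (w t / c) := by
    intro t C h hC hh hb
    calc ‖∫ s in (0:ℝ)..t, h s‖ ≤ |∫ s in (0:ℝ)..t, C * w s| := by
          apply intervalIntegral.norm_integral_le_abs_of_norm_le
          · exact Eventually.of_forall fun s => hb s
          · exact (continuous_const.mul hwc).intervalIntegrable _ _
      _ = C * |∫ s in (0:ℝ)..t, w s| := by
          rw [intervalIntegral.integral_const_mul, abs_mul, abs_of_nonneg hC]
      _ ≤ C * (w t / c) := by
          gcongr; exact integral_exp_abs_bound hc t
  have hvc := hv.continuous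
  have hgrow : ∀ e, ‖v e‖ ≤ ‖v 0‖ + K * ‖e‖ := fun e => by
    have := hv.dist_le_mul e 0
    rw [dist_eq_norm, dist_zero_right] at this
    have h2 := norm_le_insert' (v e) (v 0)
    linarith
  let raw : (ℝ → E) → ℝ → E := fun y t => (w t)⁻¹ • (x₀ + ∫ s in (0:ℝ)..t, v (w s • y s))
  have hrawc : ∀ y : BoundedContinuousFunction ℝ E, Continuous (fun s => v (w s • y s)) := fun y =>
    hvc.comp (hwc.smul y.continuous)
  have hbd : ∀ y : BoundedContinuousFunction ℝ E, ∀ t,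
      ‖raw y t‖ ≤ ‖x₀‖ + (‖v 0‖ + K * ‖y‖) / c := by
    intro y t
    have h1 := hbint t (‖v 0‖ + K * ‖y‖) (fun s => v (w s • y s)) (by positivity) (hrawc y) (by
      intro s
      refine (hgrow _).trans ?_
      rw [norm_smul, Real.norm_of_nonneg (hwpos s).le]
      have := y.norm_coe_le_norm s
      have h3 : (K:ℝ) * (w s * ‖y s‖) ≤ K * (w s * ‖y‖) := by
        have := (hwpos s).le
        gcongr
      nlinarith [hw1 s, norm_nonneg (v 0)])
    calc ‖raw y t‖ = (w t)⁻¹ * ‖x₀ + ∫ s in (0:ℝ)..t, v (w s • y s)‖ := by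
          simp only [raw]; rw [norm_smul, Real.norm_of_nonneg (inv_nonneg.2 (hwpos t).le)]
      _ ≤ (w t)⁻¹ * (‖x₀‖ + (‖v 0‖ + K * ‖y‖) * (w t / c)) := by
          have := (hwpos t).le
          gcongr
          exact (norm_add_le _ _).trans (by gcongr)
      _ = (w t)⁻¹ * ‖x₀‖ + (‖v 0‖ + K * ‖y‖) / c := by
          have := (hwpos t).ne'
          field_simp
      _ ≤ _ := by
          have : (w t)⁻¹ ≤ 1 := inv_le_one_of_one_le₀ (hw1 t)
          have := mul_le_mul_of_nonneg_right this (norm_nonneg x₀)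
          linarith
  have hderint : ∀ y : BoundedContinuousFunction ℝ E, ∀ t, HasDerivAt
      (fun t => ∫ s in (0:ℝ)..t, v (w s • y s)) (v (w t • y t)) t := fun y t =>
    intervalIntegral.integral_hasDerivAt_right ((hrawc y).intervalIntegrable _ _)
      ((hrawc y).stronglyMeasurableAtFilter _ _) (hrawc y).continuousAt
  have hcont : ∀ y : BoundedContinuousFunction ℝ E, Continuous (raw y) := fun y => by
    have h1 : Continuous (fun t => ∫ s in (0:ℝ)..t, v (w s • y s)) :=
      continuous_iff_continuousAt.2 fun t => (hderint y t).continuousAt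
    exact (hwc.inv₀ fun s => (hwpos s).ne').smul (continuous_const.add h1)
  let P : BoundedContinuousFunction ℝ E → BoundedContinuousFunction ℝ E := fun y =>
    BoundedContinuousFunction.ofNormedAddCommGroup (raw y) (hcont y) _ (hbd y)
  have hP : ContractingWith (1/2 : NNReal) P := by
    refine ⟨by rw [← NNReal.coe_lt_coe]; norm_num, LipschitzWith.of_dist_le_mul fun y₁ y₂ => ?_⟩
    rw [BoundedContinuousFunction.dist_le (by positivity)]
    intro t
    have h1 := hbint t (K * dist y₁ y₂) (fun s => v (w s • y₁ s) - v (w s • y₂ s)) (by positivity)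
      ((hrawc y₁).sub (hrawc y₂)) (by
        intro s
        have h2 := hv.dist_le_mul (w s • y₁ s) (w s • y₂ s)
        rw [dist_eq_norm, dist_eq_norm, ← smul_sub, norm_smul,
          Real.norm_of_nonneg (hwpos s).le] at h2
        refine h2.trans ?_
        have h3 := BoundedContinuousFunction.dist_coe_le_dist (f := y₁) (g := y₂) s
        have := (hwpos s).le
        rw [dist_eq_norm] at h3
        calc (K:ℝ) * (w s * ‖y₁ s - y₂ s‖) ≤ K * (w s * dist y₁ y₂) := by gcongr
          _ = _ := by ring)
    have h4 : dist (P y₁ t) (P y₂ t) =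
        (w t)⁻¹ * ‖∫ s in (0:ℝ)..t, (v (w s • y₁ s) - v (w s • y₂ s))‖ := by
      rw [intervalIntegral.integral_sub ((hrawc y₁).intervalIntegrable _ _)
        ((hrawc y₂).intervalIntegrable _ _), dist_eq_norm]
      change ‖raw y₁ t - raw y₂ t‖ = _
      simp only [raw]
      rw [← smul_sub, norm_smul, Real.norm_of_nonneg (inv_nonneg.2 (hwpos t).le),
        add_sub_add_left_eq_sub]
    rw [h4]
    calc (w t)⁻¹ * ‖∫ s in (0:ℝ)..t, (v (w s • y₁ s) - v (w s • y₂ s))‖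
        ≤ (w t)⁻¹ * (K * dist y₁ y₂ * (w t / c)) := by
          have := (hwpos t).le
          gcongr
      _ = (K / c) * dist y₁ y₂ := by
          have := (hwpos t).ne'
          field_simp
      _ ≤ _ := by
          have := mul_le_mul_of_nonneg_right hK (dist_nonneg (x := y₁) (y := y₂))
          simpa using this
  set y := hP.fixedPoint P with hy
  have hfix : P y = y := hP.fixedPoint_isFixedPt
  have hx : ∀ t, w t • y t = x₀ + ∫ s in (0:ℝ)..t, v (w s • y s) := fun t => by
    have : y t = raw y t := by
      conv_lhs => rw [← hfix]
      rfl
    conv_lhs => rw [this]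
    simp only [raw]
    rw [smul_smul, mul_inv_cancel₀ (hwpos t).ne', one_smul]
  refine ⟨fun t => w t • y t, ?_, fun t => ?_⟩
  · simp only; rw [hx 0]; simp
  · have h1 : (fun t => w t • y t) = fun t => x₀ + ∫ s in (0:ℝ)..t, v (w s • y s) := funext hx
    have h2 := (hderint y t).const_add x₀
    rw [← h1] at h2
    exact h2

/-- Gronwall, both time directions. -/
lemma dist_sol_le (v : E → E) (K : NNReal) (hv : LipschitzWith K v) {x y : ℝ → E}
    (hx : ∀ t, HasDerivAt x (v (x t)) t) (hy : ∀ t, HasDerivAt y (v (y t)) t) (t : ℝ) :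
    dist (x t) (y t) ≤ dist (x 0) (y 0) * Real.exp (K * |t|) := by
  have cx : Continuous x := continuous_iff_continuousAt.2 fun t => (hx t).continuousAt
  have cy : Continuous y := continuous_iff_continuousAt.2 fun t => (hy t).continuousAt
  rcases le_total 0 t with h | h
  · have := dist_le_of_trajectories_ODE (v := fun _ => v) (K := K) (a := 0) (b := t)
      (δ := dist (x 0) (y 0)) (fun _ => hv) cx.continuousOn
      (fun s _ => (hx s).hasDerivWithinAt) cy.continuousOn
      (fun s _ => (hy s).hasDerivWithinAt) le_rfl t ⟨h, le_rfl⟩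
    rw [abs_of_nonneg h]; rwa [sub_zero] at this
  · have hv' : LipschitzWith K (fun e => - v e) := hv.neg
    have h1 : ∀ s, HasDerivAt (fun s => x (-s)) (- v (x (-s))) s := fun s => by
      simpa [Function.comp_def] using (hx (-s)).scomp s (hasDerivAt_neg s)
    have h2 : ∀ s, HasDerivAt (fun s => y (-s)) (- v (y (-s))) s := fun s => by
      simpa [Function.comp_def] using (hy (-s)).scomp s (hasDerivAt_neg s)
    have := dist_le_of_trajectories_ODE (v := fun _ e => - v e) (K := K) (a := 0) (b := -t)
      (f := fun s => x (-s)) (g := fun s => y (-s))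
      (δ := dist (x 0) (y 0)) (fun _ => hv') (cx.comp continuous_neg).continuousOn
      (fun s _ => (h1 s).hasDerivWithinAt) (cy.comp continuous_neg).continuousOn
      (fun s _ => (h2 s).hasDerivWithinAt) (by simp) (-t) ⟨by linarith, le_rfl⟩
    simpa [abs_of_nonpos h] using this

/-- Global jointly continuous flow. -/
lemma exists_flow (v : E → E) (K : NNReal) (hv : LipschitzWith K v) :
    ∃ Φ : ℝ → E → E, (∀ x, Φ 0 x = x) ∧ (∀ x t, HasDerivAt (fun t => Φ t x) (v (Φ t x)) t) ∧
      Continuous (fun p : ℝ × E => Φ p.1 p.2) := by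
  choose x hx0 hx using exists_global v K hv
  refine ⟨fun t e => x e t, hx0, fun e t => hx e t, ?_⟩
  rw [continuous_iff_continuousAt]
  rintro ⟨t, e⟩
  rw [Metric.continuousAt_iff']
  intro ε hε
  have ct : ContinuousAt (x e) t := (hx e t).continuousAt
  have h1 : ∀ᶠ p : ℝ × E in 𝓝 (t, e), dist (x e p.1) (x e t) < ε / 2 := by
    have := (ct.tendsto.comp (continuous_fst.tendsto ((t, e) : ℝ × E)))
    exact (Metric.tendsto_nhds.1 this) _ (half_pos hε)
  have h2 : ∀ᶠ p : ℝ × E in 𝓝 (t, e), dist p.2 e * Real.exp (K * |p.1|) < ε / 2 := by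
    have : Continuous fun p : ℝ × E => dist p.2 e * Real.exp (K * |p.1|) := by fun_prop
    have h3 := this.tendsto (t, e)
    simp only [dist_self, zero_mul] at h3
    exact h3.eventually (gt_mem_nhds (half_pos hε))
  filter_upwards [h1, h2] with p hp1 hp2
  have h3 := dist_sol_le v K hv (hx p.2) (hx e) p.1
  rw [hx0, hx0] at h3
  calc dist (x p.2 p.1) (x e t) ≤ dist (x p.2 p.1) (x e p.1) + dist (x e p.1) (x e t) :=
        dist_triangle _ _ _
    _ < ε := by linarith

lemma sol_unique (v : E → E) (K : NNReal) (hv : LipschitzWith K v) {x y : ℝ → E}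
    (hx : ∀ t, HasDerivAt x (v (x t)) t) (hy : ∀ t, HasDerivAt y (v (y t)) t) {s : ℝ}
    (h : x s = y s) : x = y := by
  have hx' : ∀ t, HasDerivAt (fun t => x (t + s)) (v (x (t + s))) t := fun t =>
    (hx (t + s)).comp_add_const t s
  have hy' : ∀ t, HasDerivAt (fun t => y (t + s)) (v (y (t + s))) t := fun t =>
    (hy (t + s)).comp_add_const t s
  funext t
  have := dist_sol_le v K hv hx' hy' (t - s)
  simp only [zero_add, h, dist_self, zero_mul, sub_add_cancel] at this
  exact dist_le_zero.1 this

end Canard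
end

section

open Set Filter Topology

namespace Canard

/-- Solutions of the slow-fast system. -/
def Sol (F G : ℝ → ℝ → ℝ → ℝ) (ε : ℝ) (x y z : ℝ → ℝ) : Prop :=
  (∀ t, HasDerivAt x (F (x t) (y t) (z t)) t) ∧
  (∀ t, HasDerivAt y (G (x t) (y t) (z t)) t) ∧
  (∀ t, HasDerivAt z ((x t + |z t|) / ε) t)

/-- Solutions of the attractive reduced system. -/
def Slow (F G : ℝ → ℝ → ℝ → ℝ) (x y : ℝ → ℝ) : Prop :=
  (∀ t, HasDerivAt x (F (x t) (y t) (x t)) t) ∧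
  (∀ t, HasDerivAt y (G (x t) (y t) (x t)) t)

/-- Boundedness and Lipschitz continuity. -/
def Nice (F G : ℝ → ℝ → ℝ → ℝ) (M L : ℝ) : Prop :=
  (∀ x y z, |F x y z| ≤ M ∧ |G x y z| ≤ M) ∧
  (∀ x₁ y₁ z₁ x₂ y₂ z₂, |F x₁ y₁ z₁ - F x₂ y₂ z₂| ≤ L * (|x₁ - x₂| + |y₁ - y₂| + |z₁ - z₂|)) ∧
  (∀ x₁ y₁ z₁ x₂ y₂ z₂, |G x₁ y₁ z₁ - G x₂ y₂ z₂| ≤ L * (|x₁ - x₂| + |y₁ - y₂| + |z₁ - z₂|))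

lemma speed {φ φ' : ℝ → ℝ} {M : ℝ} (hd : ∀ t, HasDerivAt φ (φ' t) t) (hb : ∀ t, |φ' t| ≤ M)
    (s t : ℝ) : |φ t - φ s| ≤ M * |t - s| := by
  have := Convex.norm_image_sub_le_of_norm_hasDerivWithin_le (f := φ) (f' := φ') (s := univ)
    (x := s) (y := t) (C := M) (fun r _ => (hd r).hasDerivWithinAt) (fun r _ => hb r) convex_univ
    (mem_univ _) (mem_univ _)
  simpa using this

lemma growth {φ φ' : ℝ → ℝ} {c a b : ℝ} (hab : a ≤ b) (hd : ∀ t, HasDerivAt φ (φ' t) t)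
    (hb : ∀ t ∈ Icc a b, c ≤ φ' t) : c * (b - a) ≤ φ b - φ a := by
  have hdf : Differentiable ℝ φ := fun t => (hd t).differentiableAt
  refine Convex.mul_sub_le_image_sub_of_le_deriv (convex_Icc a b) hdf.continuous.continuousOn
    hdf.differentiableOn (fun t ht => ?_) a ⟨le_rfl, hab⟩ b ⟨hab, le_rfl⟩ hab
  rw [(hd t).deriv]
  exact hb t (interior_subset ht)

/-- Relaxation estimate: the derivative of d is -d/ε - k, with k bounded by M. -/
lemma relax_upper {d k : ℝ → ℝ} {ε M s₀ t₁ : ℝ} (hε : 0 < ε)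
    (hc : ∀ t ∈ Icc s₀ t₁, HasDerivAt d (-(d t) / ε - k t) t) (hk : ∀ t, |k t| ≤ M)
    {t : ℝ} (ht : t ∈ Icc s₀ t₁) :
    d t ≤ |d s₀| * Real.exp (-((t - s₀) / ε)) + M * ε := by
  have hM : 0 ≤ M := (abs_nonneg _).trans (hk 0)
  set ψ : ℝ → ℝ := fun t => Real.exp ((t - s₀) / ε) * (d t - M * ε) with hψ
  have hdψ : ∀ t ∈ Icc s₀ t₁, HasDerivAt ψ (Real.exp ((t - s₀) / ε) * (-M - k t)) t := by
    intro t ht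
    have h1 : HasDerivAt (fun t => Real.exp ((t - s₀) / ε)) (Real.exp ((t - s₀) / ε) * (1 / ε)) t :=
      (((hasDerivAt_id t).sub_const s₀).div_const ε).exp
    have h2 := h1.mul ((hc t ht).sub_const (M * ε))
    refine h2.congr_deriv ?_
    field_simp
    ring
  have hanti : AntitoneOn ψ (Icc s₀ t₁) := by
    apply antitoneOn_of_deriv_nonpos (convex_Icc _ _)
    · exact fun t ht => (hdψ t ht).continuousAt.continuousWithinAt
    · exact fun t ht => (hdψ t (interior_subset ht)).differentiableAt.differentiableWithinAt
    · intro t ht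
      rw [(hdψ t (interior_subset ht)).deriv]
      have := (abs_le.1 (hk t)).1
      exact mul_nonpos_of_nonneg_of_nonpos (Real.exp_pos _).le (by linarith)
  have h3 := hanti ⟨le_rfl, ht.1.trans ht.2⟩ ht ht.1
  simp only [hψ, sub_self, zero_div, Real.exp_zero, one_mul] at h3
  have h4 : d t - M * ε = Real.exp (-((t - s₀) / ε)) *
      (Real.exp ((t - s₀) / ε) * (d t - M * ε)) := by
    rw [← mul_assoc, ← Real.exp_add]; simp
  have h5 : d s₀ - M * ε ≤ |d s₀| := by
    have := le_abs_self (d s₀)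
    have : 0 ≤ M * ε := by positivity
    linarith
  have h6 : d t - M * ε ≤ Real.exp (-((t - s₀) / ε)) * |d s₀| := by
    rw [h4]; exact mul_le_mul_of_nonneg_left (h3.trans h5) (Real.exp_pos _).le
  linarith

lemma relax {d k : ℝ → ℝ} {ε M s₀ t₁ : ℝ} (hε : 0 < ε)
    (hc : ∀ t ∈ Icc s₀ t₁, HasDerivAt d (-(d t) / ε - k t) t) (hk : ∀ t, |k t| ≤ M)
    {t : ℝ} (ht : t ∈ Icc s₀ t₁) :
    |d t| ≤ |d s₀| * Real.exp (-((t - s₀) / ε)) + M * ε := by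
  rw [abs_le']
  refine ⟨relax_upper hε hc hk ht, ?_⟩
  have := relax_upper (d := fun t => - d t) (k := fun t => - k t) (M := M) hε
    (fun t ht => (hc t ht).neg.congr_deriv (by ring)) (fun t => by simpa using hk t) ht
  simpa using this

/-- Closeness of full orbits and slow orbits as long as `z ≤ 0`. -/
lemma close {M L P T μ : ℝ} (hM : 0 < M) (hL : 0 < L) (hP : 0 < P) (hT : 0 < T) (hμ : 0 < μ) :
    ∃ ε₀ > 0, ∀ ε, 0 < ε → ε < ε₀ → ∀ F G, Nice F G M L → ∀ x y z sx sy : ℝ → ℝ, ∀ s₀ t₁ : ℝ,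
      Sol F G ε x y z → Slow F G sx sy → x s₀ = sx s₀ → y s₀ = sy s₀ → z s₀ = 0 →
      |x s₀| ≤ P → t₁ ≤ s₀ + T → (∀ t ∈ Icc s₀ t₁, z t ≤ 0) →
      ∀ t ∈ Icc s₀ t₁, |x t - sx t| ≤ μ ∧ |y t - sy t| ≤ μ ∧ (s₀ + μ ≤ t → |z t - x t| ≤ μ) := by
  set B := Real.exp (3 * L * T) with hB
  have hB1 : 1 ≤ B := Real.one_le_exp (by positivity)
  set h := min μ (μ / (4 * M * B)) with hh
  have hhpos : 0 < h := lt_min hμ (by positivity)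
  have hhμ : h ≤ μ := min_le_left _ _
  have hh2 : 2 * M * h * B ≤ μ / 2 := by
    have : h ≤ μ / (4 * M * B) := min_le_right _ _
    rw [le_div_iff₀ (by positivity)] at this
    linarith
  have hh3 : 2 * M * h ≤ μ / 2 := by
    have : 0 ≤ 2 * M * h := by positivity
    nlinarith
  set C := P / h + M with hC
  have hCpos : 0 < C := by positivity
  refine ⟨μ / (C * B), by positivity, ?_⟩
  intro ε hε hεlt F G hN x y z sx sy s₀ t₁ hsol hslow hx0 hy0 hz0 hxP ht₁ hz
  obtain ⟨hbd, hLF, hLG⟩ := hN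
  obtain ⟨hx, hy, hzd⟩ := hsol
  obtain ⟨hsx, hsy⟩ := hslow
  have hεC : C * ε * B ≤ μ := by
    rw [lt_div_iff₀ (by positivity)] at hεlt
    nlinarith
  have hεC' : C * ε ≤ μ := by
    have : 0 ≤ C * ε := by positivity
    nlinarith
  -- relaxation
  have hrel : ∀ t ∈ Icc s₀ t₁, s₀ + h ≤ t → |z t - x t| ≤ C * ε := by
    intro t ht hth
    have h1 := relax (d := fun t => z t - x t) (k := fun t => F (x t) (y t) (z t)) (M := M)
      (ε := ε) (s₀ := s₀) (t₁ := t₁) hε (fun t ht => by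
        refine ((hzd t).sub (hx t)).congr_deriv ?_
        rw [abs_of_nonpos (hz t ht)]
        ring) (fun t => (hbd _ _ _).1) ht
    simp only [hz0, zero_sub, abs_neg] at h1
    have h2 : Real.exp (-((t - s₀) / ε)) ≤ ε / h := by
      rw [Real.exp_neg, inv_le_comm₀ (Real.exp_pos _) (by positivity), inv_div]
      have h3 := Real.add_one_le_exp ((t - s₀) / ε)
      have h4 : h / ε ≤ (t - s₀) / ε := by gcongr; linarith
      linarith
    calc |z t - x t| ≤ |x s₀| * Real.exp (-((t - s₀) / ε)) + M * ε := h1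
      _ ≤ P * (ε / h) + M * ε := by gcongr
      _ = C * ε := by rw [hC]; field_simp
  -- initial layer
  have hlay : ∀ t, s₀ ≤ t → t ≤ s₀ + h → |x t - sx t| ≤ 2 * M * h ∧ |y t - sy t| ≤ 2 * M * h := by
    intro t ht1 ht2
    have habs : |t - s₀| ≤ h := by rw [abs_of_nonneg (by linarith)]; linarith
    have e1 := (speed hx (fun t => (hbd _ _ _).1) s₀ t).trans (mul_le_mul_of_nonneg_left habs hM.le)
    have e2 := (speed hy (fun t => (hbd _ _ _).2) s₀ t).trans (mul_le_mul_of_nonneg_left habs hM.le)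
    have e3 := (speed hsx (fun t => (hbd _ _ _).1) s₀ t).trans
      (mul_le_mul_of_nonneg_left habs hM.le)
    have e4 := (speed hsy (fun t => (hbd _ _ _).2) s₀ t).trans
      (mul_le_mul_of_nonneg_left habs hM.le)
    rw [abs_le] at e1 e2 e3 e4
    rw [abs_le, abs_le]
    constructor <;> constructor <;> linarith [e1.1, e1.2, e2.1, e2.2, e3.1, e3.2, e4.1, e4.2]
  intro t ht
  by_cases hth : t ≤ s₀ + h
  · obtain ⟨a1, a2⟩ := hlay t ht.1 hth
    refine ⟨a1.trans (by linarith), a2.trans (by linarith), fun h' => ?_⟩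
    have : s₀ + h ≤ t := by linarith
    exact (hrel t ht this).trans hεC'
  · push Not at hth
    have hg := norm_le_gronwallBound_of_norm_deriv_right_le
      (f := fun t => (x t - sx t, y t - sy t))
      (f' := fun t => (F (x t) (y t) (z t) - F (sx t) (sy t) (sx t),
        G (x t) (y t) (z t) - G (sx t) (sy t) (sx t)))
      (δ := 2 * M * h) (K := 3 * L) (ε := L * (C * ε)) (a := s₀ + h) (b := t)
      (fun r _ => (((hx r).sub (hsx r)).prodMk ((hy r).sub (hsy r))).continuousAt.continuousWithinAt)
      (fun r _ => (((hx r).sub (hsx r)).prodMk ((hy r).sub (hsy r))).hasDerivWithinAt)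
      (by
        obtain ⟨a1, a2⟩ := hlay (s₀ + h) (by linarith) le_rfl
        rw [Prod.norm_def]; exact max_le a1 a2)
      (by
        intro r hr
        have hr' : r ∈ Icc s₀ t₁ := ⟨by linarith [hr.1], by linarith [hr.2, ht.2]⟩
        have h1 := hrel r hr' hr.1
        set n := ‖(x r - sx r, y r - sy r)‖ with hn
        have n1 : |x r - sx r| ≤ n := norm_fst_le (x r - sx r, y r - sy r)
        have n2 : |y r - sy r| ≤ n := norm_snd_le (x r - sx r, y r - sy r)
        have n3 : |z r - sx r| ≤ C * ε + n := by
          have := abs_add_le (z r - x r) (x r - sx r)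
          rw [sub_add_sub_cancel] at this
          linarith
        have n4 : L * (|x r - sx r| + |y r - sy r| + |z r - sx r|) ≤ 3 * L * n + L * (C * ε) := by
          have : |x r - sx r| + |y r - sy r| + |z r - sx r| ≤ 3 * n + C * ε := by linarith
          calc _ ≤ L * (3 * n + C * ε) := by gcongr
            _ = _ := by ring
        rw [Prod.norm_def]
        exact max_le ((hLF _ _ _ _ _ _).trans n4) ((hLG _ _ _ _ _ _).trans n4))
      t ⟨hth.le, le_rfl⟩
    have hbound : gronwallBound (2 * M * h) (3 * L) (L * (C * ε)) (t - (s₀ + h)) ≤ μ := by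
      rw [gronwallBound_of_K_ne_0 (by positivity)]
      have hE : Real.exp (3 * L * (t - (s₀ + h))) ≤ B := by
        rw [hB]; apply Real.exp_le_exp.2
        have : t - (s₀ + h) ≤ T := by linarith [ht.2]
        gcongr
      have hq : L * (C * ε) / (3 * L) = C * ε / 3 := by field_simp
      rw [hq]
      have h5 : 2 * M * h * Real.exp (3 * L * (t - (s₀ + h))) ≤ 2 * M * h * B := by gcongr
      have h6 : C * ε / 3 * (Real.exp (3 * L * (t - (s₀ + h))) - 1) ≤ C * ε / 3 * B := by
        gcongr; linarith
      simp only
      linarith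
    have h7 := hg.trans hbound
    refine ⟨(norm_fst_le (x t - sx t, y t - sy t)).trans h7,
      (norm_snd_le (x t - sx t, y t - sy t)).trans h7, fun h' => ?_⟩
    exact (hrel t ht hth.le).trans hεC'

end Canard
end

section

open Set Filter Topology

namespace Canard

/-- One full orbit compared with one slow orbit, with all the constants. -/
structure Orb (F G : ℝ → ℝ → ℝ → ℝ) (ε M r g0 κ κ2 μ m : ℝ) (x y z sx sy : ℝ → ℝ)
    (s₀ u : ℝ) : Prop where
  hε : 0 < ε
  hM : 0 < M
  hg0 : 0 < g0
  hμ : 0 < μ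
  hκ : 0 < κ
  hκ2 : 0 < κ2
  sol : Sol F G ε x y z
  bd : ∀ x y z, |F x y z| ≤ M ∧ |G x y z| ≤ M
  slow : Slow F G sx sy
  hG : ∀ x y z, |x| ≤ r → |y| ≤ r → g0 ≤ G x y z
  cl : ∀ t₁ ≤ κ2, (∀ t ∈ Icc s₀ t₁, z t ≤ 0) →
      ∀ t ∈ Icc s₀ t₁, |x t - sx t| ≤ μ ∧ |y t - sy t| ≤ μ ∧ (s₀ + μ ≤ t → |z t - x t| ≤ μ)
  sx0 : sx 0 = u
  sy0 : sy 0 = 0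
  neg : ∀ t ∈ Icc s₀ (-κ), sx t ≤ -m
  hm : μ < m
  z0 : z s₀ = 0
  hs : s₀ + μ ≤ -κ
  hr : |u| + M * (2 * κ + κ2) + μ ≤ r
  hμκ : μ ≤ g0 * κ / 2
  hκκ : g0 * κ2 = 2 * M * κ

variable {F G : ℝ → ℝ → ℝ → ℝ} {ε M r g0 κ κ2 μ m : ℝ} {x y z sx sy : ℝ → ℝ} {s₀ u : ℝ}

/-- At an exit of `z` from the negative half line, `x` is nonnegative. -/
lemma exit_z (hε : 0 < ε) (hsol : Sol F G ε x y z) (hz0 : z s₀ ≤ 0) {t : ℝ} (ht : s₀ ≤ t)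
    (hzt : 0 < z t) : ∃ t₁ ∈ Ico s₀ t, (∀ s ∈ Icc s₀ t₁, z s ≤ 0) ∧ z t₁ = 0 ∧ 0 ≤ x t₁ := by
  obtain ⟨t₁, h1, h2, h3, h4⟩ := first_exit ht hsol.2.2 hz0 hzt
  refine ⟨t₁, h1, h2, h3, ?_⟩
  rw [h3, abs_zero, add_zero] at h4
  by_contra h
  exact absurd h4 (not_le.2 (div_neg_of_neg_of_pos (not_le.1 h) hε))

namespace Orb

lemma z_nonpos (O : Orb F G ε M r g0 κ κ2 μ m x y z sx sy s₀ u) :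
    ∀ t ∈ Icc s₀ (-κ), z t ≤ 0 := by
  intro t ht
  by_contra hcon
  push Not at hcon
  obtain ⟨t₁, h1, h2, h3, h4⟩ := exit_z O.hε O.sol O.z0.le ht.1 hcon
  have hk := O.hκ
  have hk2 := O.hκ2
  have := (O.cl t₁ (by linarith [h1.2, ht.2]) h2 t₁ ⟨h1.1, le_rfl⟩).1
  have h5 := O.neg t₁ ⟨h1.1, by linarith [h1.2, ht.2]⟩
  have := (abs_le.1 this).2
  linarith [O.hm]

lemma x_neg (O : Orb F G ε M r g0 κ κ2 μ m x y z sx sy s₀ u) :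
    ∀ t ∈ Icc s₀ (-κ), x t < 0 := by
  intro t ht
  have hk := O.hκ
  have hk2 := O.hκ2
  have h1 := (O.cl (-κ) (by linarith) O.z_nonpos t ht).1
  have h5 := O.neg t ht
  have := (abs_le.1 h1).2
  linarith [O.hm]

lemma z_neg (O : Orb F G ε M r g0 κ κ2 μ m x y z sx sy s₀ u) :
    ∀ t ∈ Ioc s₀ (-κ), z t < 0 := by
  intro t ht
  have hε := O.hε
  set ψ : ℝ → ℝ := fun t => Real.exp (t / ε) * z t with hψ
  have hdψ : ∀ t ∈ Icc s₀ (-κ), HasDerivAt ψ (Real.exp (t / ε) * (x t / ε)) t := by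
    intro t ht
    have h1 : HasDerivAt (fun t => Real.exp (t / ε)) (Real.exp (t / ε) * (1 / ε)) t :=
      ((hasDerivAt_id t).div_const ε).exp
    refine (h1.mul (O.sol.2.2 t)).congr_deriv ?_
    rw [abs_of_nonpos (O.z_nonpos t ht)]
    ring
  have hanti : StrictAntiOn ψ (Icc s₀ (-κ)) := by
    apply strictAntiOn_of_deriv_neg (convex_Icc _ _)
    · exact fun t ht => (hdψ t ht).continuousAt.continuousWithinAt
    · intro t ht
      rw [(hdψ t (interior_subset ht)).deriv]
      exact mul_neg_of_pos_of_neg (Real.exp_pos _)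
        (div_neg_of_neg_of_pos (O.x_neg t (interior_subset ht)) hε)
  have h3 := hanti ⟨le_rfl, ht.1.le.trans ht.2⟩ ⟨ht.1.le, ht.2⟩ ht.1
  simp only [hψ, O.z0, mul_zero] at h3
  by_contra h
  push Not at h
  exact absurd h3 (not_lt.2 (mul_nonneg (Real.exp_pos _).le h))

/-- speed bounds -/
lemma spx (O : Orb F G ε M r g0 κ κ2 μ m x y z sx sy s₀ u) (s t : ℝ) :
    |x t - x s| ≤ M * |t - s| := speed O.sol.1 (fun _ => (O.bd _ _ _).1) s t

lemma spy (O : Orb F G ε M r g0 κ κ2 μ m x y z sx sy s₀ u) (s t : ℝ) :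
    |y t - y s| ≤ M * |t - s| := speed O.sol.2.1 (fun _ => (O.bd _ _ _).2) s t

lemma spsx (O : Orb F G ε M r g0 κ κ2 μ m x y z sx sy s₀ u) (s t : ℝ) :
    |sx t - sx s| ≤ M * |t - s| := speed O.slow.1 (fun _ => (O.bd _ _ _).1) s t

lemma spsy (O : Orb F G ε M r g0 κ κ2 μ m x y z sx sy s₀ u) (s t : ℝ) :
    |sy t - sy s| ≤ M * |t - s| := speed O.slow.2 (fun _ => (O.bd _ _ _).2) s t

lemma slow_win (O : Orb F G ε M r g0 κ κ2 μ m x y z sx sy s₀ u) :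
    ∀ t ∈ Icc (-κ) κ2, |sx t| ≤ r ∧ |sy t| ≤ r := by
  intro t ht
  have hk := O.hκ
  have hk2 := O.hκ2
  have ha : |t - 0| ≤ κ + κ2 := by rw [abs_le]; constructor <;> linarith [ht.1, ht.2]
  have h1 := (O.spsx 0 t).trans (mul_le_mul_of_nonneg_left ha O.hM.le)
  have h2 := (O.spsy 0 t).trans (mul_le_mul_of_nonneg_left ha O.hM.le)
  have hr := O.hr
  have hMk : 0 < M * κ := mul_pos O.hM hk
  have hu := abs_nonneg u
  have hμ := O.hμ
  rw [O.sx0] at h1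
  rw [O.sy0, sub_zero] at h2
  constructor
  · have := abs_add_le (sx t - u) u
    rw [sub_add_cancel] at this
    nlinarith
  · nlinarith

lemma win (O : Orb F G ε M r g0 κ κ2 μ m x y z sx sy s₀ u) :
    ∀ t ∈ Icc (-κ) κ2, |x t| ≤ r ∧ |y t| ≤ r := by
  intro t ht
  have hk := O.hκ
  have hk2 := O.hκ2
  have hsk : s₀ ≤ -κ := by linarith [O.hs, O.hμ]
  obtain ⟨c1, c2, -⟩ := O.cl (-κ) (by linarith) O.z_nonpos (-κ) ⟨hsk, le_rfl⟩
  have hak : |-κ - 0| = κ := by rw [sub_zero, abs_neg, abs_of_pos hk]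
  have b1 := O.spsx 0 (-κ)
  have b2 := O.spsy 0 (-κ)
  rw [hak] at b1 b2
  have ha : |t - -κ| ≤ κ + κ2 := by rw [abs_le]; constructor <;> linarith [ht.1, ht.2]
  have h1 := (O.spx (-κ) t).trans (mul_le_mul_of_nonneg_left ha O.hM.le)
  have h2 := (O.spy (-κ) t).trans (mul_le_mul_of_nonneg_left ha O.hM.le)
  have hr := O.hr
  have hu := abs_nonneg u
  have hu1 := le_abs_self u
  have hu2 := neg_abs_le u
  rw [O.sx0] at b1
  rw [O.sy0] at b2
  rw [abs_le] at *
  obtain ⟨_, _⟩ := c1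
  obtain ⟨_, _⟩ := c2
  obtain ⟨_, _⟩ := b1
  obtain ⟨_, _⟩ := b2
  obtain ⟨_, _⟩ := h1
  obtain ⟨_, _⟩ := h2
  rw [abs_le]
  refine ⟨⟨?_, ?_⟩, ?_, ?_⟩ <;> linarith

lemma y_grow (O : Orb F G ε M r g0 κ κ2 μ m x y z sx sy s₀ u) {s t : ℝ}
    (hs : -κ ≤ s) (hst : s ≤ t) (ht : t ≤ κ2) : g0 * (t - s) ≤ y t - y s :=
  growth hst O.sol.2.1 (fun r hr => by
    obtain ⟨h1, h2⟩ := O.win r ⟨hs.trans hr.1, hr.2.trans ht⟩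
    exact O.hG _ _ _ h1 h2)

lemma sy_grow (O : Orb F G ε M r g0 κ κ2 μ m x y z sx sy s₀ u) {s t : ℝ}
    (hs : -κ ≤ s) (hst : s ≤ t) (ht : t ≤ κ2) : g0 * (t - s) ≤ sy t - sy s :=
  growth hst O.slow.2 (fun r hr => by
    obtain ⟨h1, h2⟩ := O.slow_win r ⟨hs.trans hr.1, hr.2.trans ht⟩
    exact O.hG _ _ _ h1 h2)

lemma y_ends (O : Orb F G ε M r g0 κ κ2 μ m x y z sx sy s₀ u) : y (-κ) < 0 ∧ 0 < y κ2 := by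
  have hk := O.hκ
  have hk2 := O.hκ2
  have hsk : s₀ ≤ -κ := by linarith [O.hs, O.hμ]
  obtain ⟨c1, c2, -⟩ := O.cl (-κ) (by linarith) O.z_nonpos (-κ) ⟨hsk, le_rfl⟩
  have hak : |-κ - 0| = κ := by rw [sub_zero, abs_neg, abs_of_pos hk]
  have b2 := O.spsy 0 (-κ)
  rw [hak, O.sy0] at b2
  have g1 := O.sy_grow le_rfl (by linarith : -κ ≤ 0) hk2.le
  rw [O.sy0] at g1
  have g2 := O.y_grow le_rfl (by linarith : -κ ≤ κ2) le_rfl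
  have := O.hμκ
  have := O.hκκ
  have hp := mul_pos O.hg0 hk
  have hp2 := mul_pos O.hM hk
  rw [abs_le] at c2 b2
  constructor
  · linarith [c2.2]
  · linarith [c2.1, b2.1]

lemma y_neg (O : Orb F G ε M r g0 κ κ2 μ m x y z sx sy s₀ u) {T1 t : ℝ} (hT : T1 ≤ κ2)
    (hy : y T1 = 0) (ht : -κ ≤ t) (htT : t < T1) : y t < 0 := by
  have := O.y_grow ht htT.le hT
  have := mul_pos O.hg0 (sub_pos.2 htT)
  linarith

/-- No exit before `T1`. -/
lemma no_exit (O : Orb F G ε M r g0 κ κ2 μ m x y z sx sy s₀ u) {T1 : ℝ} (hT0 : -κ ≤ T1)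
    (hT : T1 ≤ κ2) (hy : y T1 = 0) (hz : ∀ t ∈ Icc s₀ T1, z t ≤ 0) :
    |T1| ≤ μ / g0 ∧ |x T1 - u| ≤ μ * (1 + M / g0) ∧ |z T1 - x T1| ≤ μ := by
  have hk := O.hκ
  have hk2 := O.hκ2
  have hg0 := O.hg0
  have hs := O.hs
  have hμ := O.hμ
  obtain ⟨c1, c2, c3⟩ := O.cl T1 hT hz T1 ⟨by linarith, le_rfl⟩
  rw [hy] at c2
  have h1 : |T1| ≤ μ / g0 := by
    rw [le_div_iff₀ hg0]
    rcases le_total 0 T1 with h | h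
    · have := O.sy_grow (by linarith : -κ ≤ 0) h hT
      rw [O.sy0] at this
      rw [abs_of_nonneg h]
      linarith [(abs_le.1 c2).1]
    · have := O.sy_grow hT0 h hk2.le
      rw [O.sy0] at this
      rw [abs_of_nonpos h]
      linarith [(abs_le.1 c2).2]
  refine ⟨h1, ?_, c3 (by linarith)⟩
  have h2 := O.spsx 0 T1
  rw [sub_zero, O.sx0] at h2
  have h3 := h2.trans (mul_le_mul_of_nonneg_left h1 O.hM.le)
  have h4 := abs_add_le (x T1 - sx T1) (sx T1 - u)
  rw [sub_add_sub_cancel] at h4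
  have : μ * (1 + M / g0) = μ + M * (μ / g0) := by ring
  linarith

/-- Fact A. -/
lemma factA (O : Orb F G ε M r g0 κ κ2 μ m x y z sx sy s₀ u) {T1 q : ℝ} (hT0 : -κ ≤ T1)
    (hT : T1 ≤ κ2) (hy : y T1 = 0) (hq : ∀ t ∈ Icc (-κ) 0, sx t ≤ - (2 * q))
    (hμq : 2 * (μ * (1 + M / g0)) < q) :
    z T1 < 0 ∧ |x T1 - u| ≤ μ * (1 + M / g0) := by
  have hk := O.hκ
  have hk2 := O.hκ2
  have hg0 := O.hg0
  have hμ := O.hμ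
  have hM := O.hM
  have hMg : 0 < M * (μ / g0) := by positivity
  have hexp : μ * (1 + M / g0) = μ + M * (μ / g0) := by ring
  have hq' : ∀ t ∈ Icc (-κ) (μ / g0), sx t ≤ -q := by
    intro t ht
    rcases le_total t 0 with h | h
    · have := hq t ⟨ht.1, h⟩
      linarith
    · have h1 := hq 0 ⟨by linarith, le_rfl⟩
      have h2 := O.spsx 0 t
      rw [sub_zero, abs_of_nonneg h] at h2
      have h3 := mul_le_mul_of_nonneg_left ht.2 hM.le
      linarith [(abs_le.1 h2).2]
  have hz : ∀ t ∈ Icc s₀ T1, z t ≤ 0 := by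
    intro t ht
    by_contra hcon
    push Not at hcon
    obtain ⟨t₁, h1, h2, h3, h4⟩ := exit_z O.hε O.sol O.z0.le ht.1 hcon
    have hkt : -κ ≤ t₁ := by
      by_contra h
      push Not at h
      linarith [O.x_neg t₁ ⟨h1.1, h.le⟩]
    have hy1 := O.y_neg hT hy hkt (h1.2.trans_le ht.2)
    obtain ⟨c1, c2, -⟩ := O.cl t₁ (by linarith [h1.2, ht.2]) h2 t₁ ⟨h1.1, le_rfl⟩
    have ht1 : t₁ ≤ μ / g0 := by
      rcases le_total t₁ 0 with h | h
      · exact h.trans (by positivity)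
      · rw [le_div_iff₀ hg0]
        have := O.sy_grow (by linarith : -κ ≤ 0) h (by linarith [h1.2, ht.2])
        rw [O.sy0] at this
        linarith [(abs_le.1 c2).1]
    have := hq' t₁ ⟨hkt, ht1⟩
    linarith [(abs_le.1 c1).2]
  obtain ⟨h1, h2, h3⟩ := O.no_exit hT0 hT hy hz
  refine ⟨?_, h2⟩
  have h4 := hq' T1 ⟨hT0, (le_abs_self _).trans h1⟩
  have hs := O.hs
  obtain ⟨c1, -, -⟩ := O.cl T1 hT hz T1 ⟨by linarith, le_rfl⟩
  linarith [(abs_le.1 c1).2, (abs_le.1 h3).2]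

/-- Fact C. -/
lemma factC (O : Orb F G ε M r g0 κ κ2 μ m x y z sx sy s₀ u) {T1 δ η : ℝ} (hT0 : -κ ≤ T1)
    (hT : T1 ≤ κ2) (hy : y T1 = 0) (hu : -δ / 2 ≤ u) (hδ : 0 < δ)
    (hF : ∀ y z, -r ≤ y → y ≤ -η → 0 < F 0 y z) (hη : M * (η / g0) ≤ δ / 2)
    (hμδ : μ * (1 + M / g0) < δ / 4) : - 3 * δ / 4 < x T1 := by
  have hk := O.hκ
  have hk2 := O.hκ2
  have hg0 := O.hg0
  have hμ := O.hμ
  have hM := O.hM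
  by_cases hz : ∀ t ∈ Icc s₀ T1, z t ≤ 0
  · obtain ⟨h1, h2, h3⟩ := O.no_exit hT0 hT hy hz
    linarith [(abs_le.1 h2).1]
  · push Not at hz
    obtain ⟨t, ht, hzt⟩ := hz
    obtain ⟨t₁, h1, h2, h3, h4⟩ := exit_z O.hε O.sol O.z0.le ht.1 hzt
    have hkt : -κ ≤ t₁ := by
      by_contra h
      push Not at h
      linarith [O.x_neg t₁ ⟨h1.1, h.le⟩]
    by_contra hcon
    push Not at hcon
    have htT : t₁ < T1 := h1.2.trans_le ht.2
    obtain ⟨t', e1, e2, e3, e4⟩ := first_exit (φ := fun t => - x t) htT.le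
      (fun t => (O.sol.1 t).neg) (by linarith) (by linarith)
    have e3' : x t' = 0 := by linarith
    rw [e3'] at e4
    have hwin := O.win t' ⟨by linarith [e1.1], by linarith [e1.2]⟩
    have hyη : -η < y t' := by
      by_contra h
      push Not at h
      linarith [hF (y t') (z t') (abs_le.1 hwin.2).1 h]
    have hgr := O.y_grow (by linarith [e1.1]) e1.2.le hT
    have h5 : T1 - t' ≤ η / g0 := by
      rw [le_div_iff₀ hg0]; linarith
    have h6 := O.spx t' T1
    rw [e3', abs_of_pos (sub_pos.2 e1.2)] at h6
    have h7 := mul_le_mul_of_nonneg_left h5 hM.le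
    linarith [(abs_le.1 h6).1]

/-- Fact B. -/
lemma factB (O : Orb F G ε M r g0 κ κ2 μ m x y z sx sy s₀ u) {T1 δ η c h m1 ρ1 K : ℝ}
    (hT : T1 ≤ κ2) (hT0 : -κ ≤ T1) (hy : y T1 = 0) (hu : u = δ) (hc : 0 < c) (hcδ : M * c ≤ δ / 2) (hcκ : c ≤ κ)
    (hF : ∀ x y z, |x| ≤ ρ1 → -r ≤ y → y ≤ -η → m1 ≤ F x y z) (hm1 : 0 < m1) (hρ1 : 0 < ρ1)
    (hη : 0 < η) (hηc : η ≤ g0 * c / 8) (hh : 0 < h) (hhc : M * h ≤ g0 * c / 8) (hhc' : h ≤ c / 2)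
    (hμδ : 2 * μ < δ / 2) (hμc : μ ≤ g0 * c / 4) (hK : r < K)
    (hεK : K * (4 * ε) ≤ min (m1 / 2) (ρ1 / h) * h * h) : K ≤ z T1 := by
  have hk := O.hκ
  have hk2 := O.hκ2
  have hg0 := O.hg0
  have hμ := O.hμ
  have hM := O.hM
  have hs := O.hs
  have hε := O.hε
  -- an exit happens before `-c/2`
  have hex : ∃ t ∈ Icc s₀ (-c / 2), 0 < z t := by
    by_contra hcon
    push Not at hcon
    obtain ⟨c1, c2, c3⟩ := O.cl (-c / 2) (by linarith) hcon (-c / 2) ⟨by linarith, le_rfl⟩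
    have c3 := c3 (by linarith)
    have h1 := O.spsx 0 (-c / 2)
    rw [O.sx0, sub_zero, abs_of_neg (by linarith : -c / 2 < 0)] at h1
    have h2 := hcon (-c / 2) ⟨by linarith, le_rfl⟩
    have : M * (-(-c / 2)) = M * c / 2 := by ring
    have := mul_pos hM hc
    linarith [(abs_le.1 c1).1, (abs_le.1 c3).1, (abs_le.1 h1).1]
  obtain ⟨t, ht, hzt⟩ := hex
  obtain ⟨t₁, h1, h2, h3, h4⟩ := exit_z O.hε O.sol O.z0.le ht.1 hzt
  have hkt : -κ ≤ t₁ := by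
    by_contra h
    push Not at h
    linarith [O.x_neg t₁ ⟨h1.1, h.le⟩]
  have ht1c : t₁ < -c / 2 := h1.2.trans_le ht.2
  have hy1 : y t₁ ≤ -(g0 * c / 4) := by
    obtain ⟨c1, c2, -⟩ := O.cl t₁ (by linarith) h2 t₁ ⟨h1.1, le_rfl⟩
    have := O.sy_grow hkt (by linarith : t₁ ≤ 0) hk2.le
    rw [O.sy0] at this
    have : g0 * (c / 2) ≤ g0 * (0 - t₁) := mul_le_mul_of_nonneg_left (by linarith) hg0.le
    linarith [(abs_le.1 c2).2]
  have hyη : ∀ s ∈ Icc t₁ (t₁ + h), -r ≤ y s ∧ y s ≤ -η := by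
    intro s hs
    refine ⟨(abs_le.1 (O.win s ⟨by linarith [hs.1], by linarith [hs.2]⟩).2).1, ?_⟩
    have h5 := O.spy t₁ s
    rw [abs_of_nonneg (by linarith [hs.1] : (0:ℝ) ≤ s - t₁)] at h5
    have : M * (s - t₁) ≤ M * h := mul_le_mul_of_nonneg_left (by linarith [hs.2]) hM.le
    linarith [(abs_le.1 h5).2]
  set m2 := min (m1 / 2) (ρ1 / h) with hm2
  have hm2p : 0 < m2 := lt_min (by positivity) (by positivity)
  have hm2h : m2 * h ≤ ρ1 := by
    have : m2 ≤ ρ1 / h := min_le_right _ _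
    rwa [le_div_iff₀ hh] at this
  have hm2m : m2 ≤ m1 / 2 := min_le_left _ _
  have hxg : ∀ s ∈ Icc t₁ (t₁ + h), m2 * (s - t₁) ≤ x s := by
    intro s hs
    by_contra hcon
    push Not at hcon
    obtain ⟨t', e1, e2, e3, e4⟩ := first_exit (φ := fun s => m2 * (s - t₁) - x s) hs.1
      (fun t => (((hasDerivAt_id t).sub_const t₁).const_mul m2).sub (O.sol.1 t))
      (by simpa using h4) (by linarith)
    have e5 : x t' = m2 * (t' - t₁) := by linarith
    have e6 : 0 ≤ m2 * (t' - t₁) := mul_nonneg hm2p.le (by linarith [e1.1])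
    have e7 : m2 * (t' - t₁) ≤ m2 * h := mul_le_mul_of_nonneg_left (by linarith [e1.2, hs.2]) hm2p.le
    have e8 := hyη t' ⟨e1.1, by linarith [e1.2, hs.2]⟩
    have e9 := hF (x t') (y t') (z t') (by rw [abs_of_nonneg (by linarith)]; linarith) e8.1 e8.2
    linarith
  have hz1 : 0 ≤ z (t₁ + h / 2) := by
    have := growth (a := t₁) (b := t₁ + h / 2) (c := 0) (by linarith) O.sol.2.2 (fun s hs => by
      have h5 := hxg s ⟨hs.1, by linarith [hs.2]⟩
      have h6 : 0 ≤ m2 * (s - t₁) := mul_nonneg hm2p.le (by linarith [hs.1])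
      have := abs_nonneg (z s)
      exact div_nonneg (by linarith) hε.le)
    rw [h3] at this
    linarith
  have hz2 : K ≤ z (t₁ + h) := by
    have := growth (a := t₁ + h / 2) (b := t₁ + h) (c := m2 * (h / 2) / ε) (by linarith) O.sol.2.2
      (fun s hs => by
        have h5 := hxg s ⟨by linarith [hs.1], hs.2⟩
        have h6 : m2 * (h / 2) ≤ m2 * (s - t₁) :=
          mul_le_mul_of_nonneg_left (by linarith [hs.1]) hm2p.le
        have := abs_nonneg (z s)
        exact div_le_div_of_nonneg_right (by linarith) hε.le)
    have h7 : K ≤ m2 * (h / 2) / ε * (t₁ + h - (t₁ + h / 2)) := by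
      have : m2 * (h / 2) / ε * (t₁ + h - (t₁ + h / 2)) = m2 * h * h / (4 * ε) := by
        field_simp; ring
      rw [this, le_div_iff₀ (by positivity)]
      exact hεK
    linarith
  have htT : t₁ + h ≤ T1 := by
    by_contra hcon
    push Not at hcon
    have := O.y_grow hT0 hcon.le (by linarith)
    rw [hy] at this
    have h8 := (hyη (t₁ + h) ⟨by linarith, le_rfl⟩).2
    have := mul_pos hg0 (sub_pos.2 hcon)
    linarith
  by_contra hcon
  push Not at hcon
  obtain ⟨t', e1, e2, e3, e4⟩ := first_exit (φ := fun s => K - z s) htT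
    (fun t => (O.sol.2.2 t).const_sub K) (by linarith) (by linarith)
  have e5 : z t' = K := by linarith
  have hw := (abs_le.1 (O.win t' ⟨by linarith [e1.1], by linarith [e1.2]⟩).1).1
  have hw0 : 0 ≤ r := (abs_nonneg _).trans (O.win 0 ⟨by linarith, by linarith⟩).1
  rw [e5, abs_of_pos (by linarith)] at e4
  have : 0 < (x t' + K) / ε := div_pos (by linarith) hε
  linarith

/-- Fact 7. -/
lemma z_lower (O : Orb F G ε M r g0 κ κ2 μ m x y z sx sy s₀ u) {T1 K : ℝ} (hsT : s₀ ≤ T1)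
    (hK : 0 < K) (hx : ∀ t ∈ Icc s₀ T1, -K < x t) : -K ≤ z T1 := by
  by_contra hcon
  push Not at hcon
  obtain ⟨t', e1, e2, e3, e4⟩ := first_exit (φ := fun s => -K - z s) hsT
    (fun t => (O.sol.2.2 t).const_sub (-K)) (by simp only [O.z0]; linarith) (by linarith)
  have e5 : z t' = -K := by linarith
  have hw := hx t' ⟨e1.1, e1.2.le⟩
  rw [e5, abs_neg, abs_of_pos hK] at e4
  have : 0 < (x t' + K) / ε := div_pos (by linarith) O.hε
  linarith

end Orb

end Canard
end

section

open Set Filter Topology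

namespace Canard

/-- Clamping of `z` to `[-(|x|+ρ), |x|+ρ]`. -/
noncomputable def clp (x ρ z : ℝ) : ℝ := max (-(|x| + ρ)) (min (|x| + ρ) z)

/-- Clamped vector field component. -/
noncomputable def Cl (f : ℝ → ℝ → ℝ → ℝ) (ρ : ℝ) (x y z : ℝ) : ℝ := f x y (clp x ρ z)

lemma abs_clp_le {x ρ z : ℝ} (hρ : 0 ≤ ρ) : |clp x ρ z| ≤ |x| + ρ := by
  have := abs_nonneg x
  rw [clp, abs_le]
  exact ⟨le_max_left _ _, max_le (by linarith) (min_le_left _ _)⟩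

lemma clp_eq {x ρ z : ℝ} (hz : |z| ≤ |x| + ρ) : clp x ρ z = z := by
  rw [abs_le] at hz
  rw [clp, min_eq_right hz.2, max_eq_right hz.1]

lemma clp_neg {x ρ z : ℝ} (hρ : 0 ≤ ρ) : clp x ρ (-z) = - clp x ρ z := by
  have hx := abs_nonneg x
  unfold clp
  have h1 := max_neg_neg (|x| + ρ) z
  have h2 := min_neg_neg (|x| + ρ) z
  rcases le_total z (|x| + ρ) with h | h
  · rcases le_total z (-(|x| + ρ)) with h' | h'
    · rw [min_eq_right h, max_eq_left h', min_eq_left (by linarith), max_eq_right (by linarith)]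
      ring
    · rw [min_eq_right h, max_eq_right h', min_eq_right (by linarith), max_eq_right (by linarith)]
  · rw [min_eq_right (by linarith : -z ≤ |x| + ρ), max_eq_left (by linarith : -z ≤ -(|x| + ρ)),
      min_eq_left h, max_eq_right (by linarith : -(|x| + ρ) ≤ |x| + ρ)]

lemma clp_lip {x ρ z x' z' : ℝ} : |clp x ρ z - clp x' ρ z'| ≤ |x - x'| + |z - z'| := by
  unfold clp
  have h1 : |(|x| + ρ) - (|x'| + ρ)| ≤ |x - x'| := by
    rw [add_sub_add_right_eq_sub]; exact abs_abs_sub_abs_le_abs_sub x x'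
  have h2 : |-(|x| + ρ) - -(|x'| + ρ)| ≤ |x - x'| := by
    rw [neg_sub_neg, abs_sub_comm]; exact h1
  have h3 := abs_min_sub_min_le_max (|x| + ρ) z (|x'| + ρ) z'
  have h4 := abs_max_sub_max_le_max (-(|x| + ρ)) (min (|x| + ρ) z) (-(|x'| + ρ)) (min (|x'| + ρ) z')
  have n1 := abs_nonneg (x - x')
  have n2 := abs_nonneg (z - z')
  refine h4.trans (max_le (by linarith) (h3.trans (max_le (by linarith) (by linarith))))

lemma Cl_diag {f : ℝ → ℝ → ℝ → ℝ} {ρ : ℝ} (hρ : 0 ≤ ρ) (x y : ℝ) : Cl f ρ x y x = f x y x := by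
  rw [Cl, clp_eq (by linarith)]

lemma nice_Cl {f g : ℝ → ℝ → ℝ → ℝ} {M lam : ℝ} (hlam : 0 ≤ lam) (h : Nice f g M lam) (ρ : ℝ) :
    Nice (Cl f ρ) (Cl g ρ) M (2 * lam + 1) := by
  obtain ⟨h1, h2, h3⟩ := h
  have key : ∀ x₁ y₁ z₁ x₂ y₂ z₂ : ℝ,
      lam * (|x₁ - x₂| + |y₁ - y₂| + |clp x₁ ρ z₁ - clp x₂ ρ z₂|) ≤
      (2 * lam + 1) * (|x₁ - x₂| + |y₁ - y₂| + |z₁ - z₂|) := by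
    intro x₁ y₁ z₁ x₂ y₂ z₂
    have := clp_lip (x := x₁) (ρ := ρ) (z := z₁) (x' := x₂) (z' := z₂)
    have n1 := abs_nonneg (x₁ - x₂)
    have n2 := abs_nonneg (y₁ - y₂)
    have n3 := abs_nonneg (z₁ - z₂)
    have := mul_le_mul_of_nonneg_left this hlam
    have := mul_nonneg hlam n2
    have := mul_nonneg hlam n3
    nlinarith
  exact ⟨fun x y z => h1 _ _ _, fun x₁ y₁ z₁ x₂ y₂ z₂ => (h2 _ _ _ _ _ _).trans (key _ _ _ _ _ _),
    fun x₁ y₁ z₁ x₂ y₂ z₂ => (h3 _ _ _ _ _ _).trans (key _ _ _ _ _ _)⟩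

lemma slow_Cl {f g : ℝ → ℝ → ℝ → ℝ} {x y : ℝ → ℝ} {ρ : ℝ} (hρ : 0 ≤ ρ) (h : Slow f g x y) :
    Slow (Cl f ρ) (Cl g ρ) x y :=
  ⟨fun t => by rw [Cl_diag hρ]; exact h.1 t, fun t => by rw [Cl_diag hρ]; exact h.2 t⟩

lemma small (c : ℝ) {d : ℝ} (hd : 0 < d) : ∀ᶠ κ in 𝓝[>] (0 : ℝ), c * κ < d := by
  have : Tendsto (fun κ : ℝ => c * κ) (𝓝 0) (𝓝 (c * 0)) := (continuous_const_mul c).tendsto 0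
  rw [mul_zero] at this
  exact (this.eventually (gt_mem_nhds hd)).filter_mono nhdsWithin_le_nhds

lemma compact_neg {α : Type*} [TopologicalSpace α] {s : Set α} (hs : IsCompact s) {h : α → ℝ}
    (hc : ContinuousOn h s) (hn : ∀ a ∈ s, h a < 0) : ∃ q > 0, ∀ a ∈ s, h a ≤ -q := by
  rcases s.eq_empty_or_nonempty with rfl | hne
  · exact ⟨1, one_pos, by simp⟩
  · obtain ⟨a, ha, hmax⟩ := hs.exists_isMaxOn hne hc
    exact ⟨-h a, by linarith [hn a ha], fun b hb => by rw [neg_neg]; exact hmax hb⟩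

lemma tube {H : ℝ × ℝ → ℝ} (hH : Continuous H) {a b : ℝ} (hn : ∀ t ∈ Icc a b, H (0, t) < 0) :
    ∃ δ > 0, ∃ m > 0, ∀ u, |u| ≤ δ → ∀ t ∈ Icc a b, H (u, t) ≤ -m := by
  obtain ⟨q, hq, hq'⟩ := compact_neg (isCompact_Icc (a := a) (b := b))
    (h := fun t => H (0, t)) (by fun_prop) hn
  have hopen : IsOpen {p : ℝ × ℝ | H p < -(q / 2)} := isOpen_lt hH continuous_const
  obtain ⟨U, V, hU, -, hU0, hV, hUV⟩ := generalized_tube_lemma (isCompact_singleton (x := (0 : ℝ)))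
    (isCompact_Icc (a := a) (b := b)) hopen (by
      rintro ⟨u, t⟩ ⟨hu, ht⟩
      simp only [mem_singleton_iff] at hu
      subst hu
      have := hq' t ht
      simp only [mem_ofPred_eq]
      linarith)
  obtain ⟨δ, hδ, hball⟩ := Metric.isOpen_iff.1 hU 0 (hU0 rfl)
  refine ⟨δ / 2, by positivity, q / 2, by positivity, fun u hu t ht => ?_⟩
  have h1 : u ∈ U := hball (by rw [Metric.mem_ball, dist_zero_right, Real.norm_eq_abs]; linarith)
  have := hUV (mk_mem_prod h1 (hV ht))
  exact le_of_lt this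

/-- The data for one half of the construction. -/
structure Data (f g : ℝ → ℝ → ℝ → ℝ) (M lam Ta τ : ℝ) (sx sy : ℝ → ℝ → ℝ) : Prop where
  hM : 0 < M
  hlam : 0 ≤ lam
  nice : Nice f g M lam
  hg : 0 < g 0 0 0
  yf : ∀ y, y ≠ 0 → y * f 0 y 0 < 0
  slow : ∀ u, Slow f g (sx u) (sy u)
  sx0 : ∀ u, sx u 0 = u
  sy0 : ∀ u, sy u 0 = 0
  csx : Continuous fun p : ℝ × ℝ => sx p.1 p.2
  hTa : Ta < τ
  hτ : τ < 0
  neg : ∀ t, Ta < t → t < 0 → sx 0 t < 0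

/-- Conclusions about one orbit. -/
structure Concl (δ K K' xs a b u s₀ : ℝ) (x y z : ℝ → ℝ) : Prop where
  ya : y (-a) < 0
  yb : 0 < y b
  mono : StrictMonoOn y (Icc (-a) b)
  A : ∀ T1 ∈ Icc (-a) b, y T1 = 0 → u ≤ -δ / 2 → z T1 < 0
  A' : ∀ T1 ∈ Icc (-a) b, y T1 = 0 → u = -δ → x T1 ≤ -3 * δ / 4
  C : ∀ T1 ∈ Icc (-a) b, y T1 = 0 → -δ / 2 ≤ u → -3 * δ / 4 < x T1
  B : ∀ T1 ∈ Icc (-a) b, y T1 = 0 → u = δ → K' ≤ z T1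
  low : ∀ T1 ∈ Icc (-a) b, y T1 = 0 → -K ≤ z T1
  ret : ∀ T1 ∈ Icc (-a) b, y T1 = 0 → ∀ t ∈ Ioc s₀ T1, z t = 0 → xs / 2 < x t

/-- slow orbits through `(u,0)` with `u < 0` stay in `x < 0` for negative times. -/
lemma slow_barrier {f g : ℝ → ℝ → ℝ → ℝ} {x y : ℝ → ℝ} (h : Slow f g x y)
    (yf : ∀ y, y ≠ 0 → y * f 0 y 0 < 0) {a : ℝ} (hx : x 0 < 0)
    (hy : ∀ t ∈ Ico (-a) 0, y t < 0) : ∀ t ∈ Icc (-a) 0, x t < 0 := by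
  intro t ht
  by_contra hcon
  push Not at hcon
  obtain ⟨t', e1, e2, e3, e4⟩ := first_exit (φ := fun t => - x t) ht.2
      (fun t => (h.1 t).neg) (by linarith) (by linarith)
  have e5 : x t' = 0 := by linarith
  rw [e5] at e4
  have e6 := hy t' ⟨ht.1.trans e1.1, e1.2⟩
  have e7 := yf _ e6.ne
  nlinarith

set_option maxHeartbeats 2000000 in
lemma half {f g : ℝ → ℝ → ℝ → ℝ} {M lam Ta τ : ℝ} {sx sy : ℝ → ℝ → ℝ}
    (D : Data f g M lam Ta τ sx sy) :
    ∃ K : ℝ, ∀ η > 0, ∃ β > 0, ∃ a > 0, ∃ b > 0, β ≤ η ∧ a ≤ η ∧ b ≤ η ∧ τ + β < -a ∧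
    ∃ δ0 > 0, (∀ u, |u| ≤ δ0 → ∀ s₀ ∈ Icc (τ - β) (τ + β), sx u s₀ ≤ sx 0 τ / 2) ∧
    ∀ δ, 0 < δ → δ ≤ δ0 → ∃ ρ0 > 0, ∀ ρ, 0 < ρ → ρ ≤ ρ0 → ∀ K' : ℝ, ∃ ε0 > 0,
    ∀ ε, 0 < ε → ε < ε0 → ∀ u ∈ Icc (-δ) δ, ∀ s₀ ∈ Icc (τ - β) (τ + β), ∀ x y z : ℝ → ℝ,
    Sol (Cl f ρ) (Cl g ρ) ε x y z → x s₀ = sx u s₀ → y s₀ = sy u s₀ → z s₀ = 0 →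
    Concl δ K K' (sx 0 τ) a b u s₀ x y z := by
  obtain ⟨hM, hlam, nice, hg, yf, slow, sx0, sy0, csx, hTa, hτ, neg⟩ := D
  obtain ⟨bd, lipf, lipg⟩ := id nice
  have hxs : sx 0 τ < 0 := neg τ hTa hτ
  set xs := sx 0 τ with hxsdef
  set P := 1 + M * (-τ + 1) with hP
  have hPpos : 0 < P := by
    have : 0 < M * (-τ + 1) := mul_pos hM (by linarith)
    linarith
  refine ⟨P + M * (-τ + 2) + 1, fun η hη => ?_⟩
  set g0 := g 0 0 0 / 2 with hg0def
  have hg0 : 0 < g0 := by positivity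
  obtain ⟨r, hr1, hr2, hr0 : 0 < r⟩ := ((small (-1 / xs * 4) one_pos).and
    ((small (4 * lam) hg0).and eventually_mem_nhdsWithin)).exists
  have hr1 : r < -xs / 4 := by
    have h1 : -1 / xs * 4 * r = r / (-xs / 4) := by field_simp
    rw [h1, div_lt_one (by linarith)] at hr1
    exact hr1
  have hGg : ∀ ρ, 0 < ρ → ρ ≤ r → ∀ x y z, |x| ≤ r → |y| ≤ r → g0 ≤ Cl g ρ x y z := by
    intro ρ hρ hρr x y z hx hy
    have h1 := lipg x y (clp x ρ z) 0 0 0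
    simp only [sub_zero] at h1
    have h2 := abs_clp_le (x := x) (z := z) hρ.le
    have h3 : lam * (|x| + |y| + |clp x ρ z|) ≤ lam * (4 * r) :=
      mul_le_mul_of_nonneg_left (by linarith) hlam
    have h4 := (abs_le.1 h1).1
    rw [Cl]
    linarith
  set cc := 2 * M / g0 with hcc
  have hccp : 0 < cc := by positivity
  obtain ⟨κ, k1, k2, k3, k4, k5, hκ : 0 < κ⟩ := ((small 4 (by linarith : 0 < -τ)).and ((small 1 hη).and
    ((small cc hη).and ((small cc one_pos).and ((small (M * (2 + cc)) (half_pos hr0)).and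
      eventually_mem_nhdsWithin))))).exists
  obtain ⟨β, b1, b2, b3, b4, b5, hβ : 0 < β⟩ := ((small 4 (by linarith : 0 < -τ)).and
    ((small 1 hη).and ((small 1 one_pos).and ((small M (by linarith : 0 < -xs / 2)).and
      ((small 1 (sub_pos.2 hTa)).and eventually_mem_nhdsWithin))))).exists
  set κ2 := cc * κ with hkapdef
  have hκ2 : 0 < κ2 := by positivity
  have hκκ : g0 * κ2 = 2 * M * κ := by rw [hkapdef, hcc]; field_simp
  refine ⟨β, hβ, κ, hκ, κ2, hκ2, by linarith, by linarith, by linarith, by linarith, ?_⟩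
  obtain ⟨δa, hδa, m, hm, hma⟩ := tube (H := fun p => sx p.1 p.2) csx (a := τ - β) (b := -κ)
    (fun t ht => neg t (by linarith [ht.1]) (by linarith [ht.2]))
  have spd : ∀ u s t, |sx u t - sx u s| ≤ M * |t - s| := fun u s t =>
    speed (slow u).1 (fun _ => (bd _ _ _).1) s t
  have spdy : ∀ u s t, |sy u t - sy u s| ≤ M * |t - s| := fun u s t =>
    speed (slow u).2 (fun _ => (bd _ _ _).2) s t
  obtain ⟨δb, hδb, mb, hmb, hmb'⟩ := tube (H := fun p => sx p.1 p.2 - xs / 2)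
    (csx.sub continuous_const) (a := τ - β) (b := τ + β) (fun t ht => by
      have h1 := spd 0 τ t
      have h2 : |t - τ| ≤ β := by rw [abs_le]; constructor <;> linarith [ht.1, ht.2]
      have h3 := mul_le_mul_of_nonneg_left h2 hM.le
      have := (abs_le.1 h1).2
      simp only
      linarith)
  refine ⟨min (min δa δb) (min (r / 4) 1), by positivity, ?_, ?_⟩
  · intro u hu s hs
    have := hmb' u (hu.trans ((min_le_left _ _).trans (min_le_right _ _))) s hs
    simp only at this
    linarith
  intro δ hδ hδ0
  have hδa' : δ ≤ δa := hδ0.trans ((min_le_left _ _).trans (min_le_left _ _))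
  have hδr : δ ≤ r / 4 := hδ0.trans ((min_le_right _ _).trans (min_le_left _ _))
  have hδ1 : δ ≤ 1 := hδ0.trans ((min_le_right _ _).trans (min_le_right _ _))
  -- slow orbit margin
  obtain ⟨q, hq, hq'⟩ : ∃ q > 0, ∀ u ∈ Icc (-δ) (-δ / 2), ∀ t ∈ Icc (-κ) 0, sx u t ≤ -(2 * q) := by
    obtain ⟨q, hq, h⟩ := compact_neg ((isCompact_Icc (a := -δ) (b := -δ / 2)).prod
      (isCompact_Icc (a := -κ) (b := 0))) (h := fun p : ℝ × ℝ => sx p.1 p.2) csx.continuousOn (by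
        rintro ⟨u, t⟩ ⟨hu, ht⟩
        simp only [mem_Icc] at hu
        refine slow_barrier (slow u) yf (a := κ) (by rw [sx0]; linarith [hu.2]) ?_ t ht
        intro s hs
        have hwin : ∀ s' ∈ Icc (-κ) 0, |sx u s'| ≤ r ∧ |sy u s'| ≤ r := by
          intro s' hs'
          have h1 := spd u 0 s'
          have h2 := spdy u 0 s'
          rw [sub_zero, abs_of_nonpos hs'.2] at h1 h2
          rw [sx0] at h1
          rw [sy0, sub_zero] at h2
          have h3 : M * -s' ≤ M * κ := mul_le_mul_of_nonneg_left (by linarith [hs'.1]) hM.le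
          have h4 : M * (2 + cc) * κ = 2 * (M * κ) + M * (cc * κ) := by ring
          have h5 : 0 < M * (cc * κ) := by positivity
          have h6 : 0 < M * κ := by positivity
          refine ⟨?_, by linarith⟩
          rw [abs_le] at h1 ⊢
          constructor <;> linarith [h1.1, h1.2]
        have hgr := growth (φ := sy u) (c := g0) hs.2.le (slow u).2 (fun s' hs' => by
          have h := hwin s' ⟨hs.1.trans hs'.1, hs'.2⟩
          have := hGg r hr0 le_rfl (sx u s') (sy u s') (sx u s') h.1 h.2
          rwa [Cl_diag hr0.le] at this)
        rw [sy0] at hgr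
        have := mul_pos hg0 (by linarith [hs.2] : 0 < 0 - s)
        linarith)
    refine ⟨q / 2, by positivity, fun u hu t ht => ?_⟩
    have := h (u, t) ⟨hu, ht⟩
    simp only at this
    linarith
  set c := min κ (δ / (2 * M)) with hcdef
  have hc : 0 < c := lt_min hκ (by positivity)
  have hcκ : c ≤ κ := min_le_left _ _
  have hcδ : M * c ≤ δ / 2 := by
    have : c ≤ δ / (2 * M) := min_le_right _ _
    rw [le_div_iff₀ (by positivity)] at this
    linarith
  obtain ⟨h, h1, h2, hh : 0 < h⟩ := ((small M (by positivity : 0 < g0 * c / 8)).and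
    ((small 1 (half_pos hc)).and eventually_mem_nhdsWithin)).exists
  obtain ⟨η', e1, e2, hη' : 0 < η'⟩ := ((small 1 (by positivity : 0 < g0 * c / 8)).and
    ((small (M / g0) (half_pos hδ)).and eventually_mem_nhdsWithin)).exists
  have cf : Continuous fun y => f 0 y 0 := by
    refine (LipschitzWith.of_dist_le_mul (K := ⟨lam, hlam⟩) fun y y' => ?_).continuous
    have := lipf 0 y 0 0 y' 0
    simp only [sub_self, abs_zero, zero_add, add_zero] at this
    exact this
  obtain ⟨m1, hm1, hm1'⟩ : ∃ m1 > 0, ∀ y ∈ Icc (-r) (-η'), 2 * m1 ≤ f 0 y 0 := by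
    obtain ⟨m1, hm1, h⟩ := compact_neg (isCompact_Icc (a := -r) (b := -η'))
      (h := fun y => - f 0 y 0) cf.neg.continuousOn (fun y hy => by
        have := yf y (by linarith [hy.2])
        have hyn : y < 0 := by linarith [hy.2]
        nlinarith)
    exact ⟨m1 / 2, by positivity, fun y hy => by linarith [h y hy]⟩
  obtain ⟨ρ1, p1, hρ1 : 0 < ρ1⟩ := ((small (3 * lam) hm1).and eventually_mem_nhdsWithin).exists
  have hFf : ∀ ρ, 0 < ρ → ρ ≤ ρ1 → ∀ x y z, |x| ≤ ρ1 → -r ≤ y → y ≤ -η' → m1 ≤ Cl f ρ x y z := by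
    intro ρ hρ hρr x y z hx hy1 hy2
    have h1 := lipf x y (clp x ρ z) 0 y 0
    simp only [sub_zero, sub_self, abs_zero, add_zero] at h1
    have h2 := abs_clp_le (x := x) (z := z) hρ.le
    have h3 : lam * (|x| + |clp x ρ z|) ≤ lam * (3 * ρ1) :=
      mul_le_mul_of_nonneg_left (by linarith) hlam
    have h4 := (abs_le.1 h1).1
    have h5 := hm1' y ⟨hy1, hy2⟩
    rw [Cl]
    linarith
  refine ⟨min r ρ1, lt_min hr0 hρ1, fun ρ hρ hρ0 K' => ?_⟩
  have hρr : ρ ≤ r := hρ0.trans (min_le_left _ _)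
  have hρρ : ρ ≤ ρ1 := hρ0.trans (min_le_right _ _)
  obtain ⟨μ, u1, u2, u3, u4, u5, u6, u7, u8, hμ : 0 < μ⟩ := ((small 1 hm).and
    ((small 4 (by linarith : 0 < -τ)).and ((small 4 hr0).and
    ((small 1 (by positivity : 0 < g0 * κ / 2)).and ((small (2 * (1 + M / g0)) hq).and
    ((small (1 + M / g0) (by positivity : 0 < δ / 4)).and ((small 2 (half_pos hδ)).and
    ((small 1 (by positivity : 0 < g0 * c / 4)).and eventually_mem_nhdsWithin)))))))).exists
  obtain ⟨εa, hεa, hclose⟩ := close (M := M) (L := 2 * lam + 1) (P := P) (T := -τ + 3) (μ := μ) hM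
    (by linarith) hPpos (by linarith) hμ
  set m2 := min (m1 / 2) (ρ1 / h) with hm2
  have hm2p : 0 < m2 := lt_min (by positivity) (by positivity)
  obtain ⟨εb, v1, hεb : 0 < εb⟩ := ((small (max K' (r + 1) * 4)
    (by positivity : 0 < m2 * h * h)).and eventually_mem_nhdsWithin).exists
  refine ⟨min εa εb, lt_min hεa hεb, ?_⟩
  intro ε hε hεlt u hu s₀ hs₀ x y z hsol hx0 hy0 hz0
  have hεεa : ε < εa := hεlt.trans_le (min_le_left _ _)
  have hεεb : ε < εb := hεlt.trans_le (min_le_right _ _)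
  have habsu : |u| ≤ δ := abs_le.2 hu
  have hxP : |x s₀| ≤ P := by
    have h1 := spd u 0 s₀
    have h2 : |s₀ - 0| ≤ -τ + 1 := by
      rw [abs_le]; constructor <;> linarith [hs₀.1, hs₀.2]
    have h3 := mul_le_mul_of_nonneg_left h2 hM.le
    rw [hx0]
    rw [sx0] at h1
    have := abs_add_le (sx u s₀ - u) u
    rw [sub_add_cancel] at this
    linarith
  have hsk : s₀ + μ ≤ -κ := by linarith [hs₀.2]
  have O : Orb (Cl f ρ) (Cl g ρ) ε M r g0 κ κ2 μ m x y z (sx u) (sy u) s₀ u :=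
    { hε := hε, hM := hM, hg0 := hg0, hμ := hμ, hκ := hκ, hκ2 := hκ2, sol := hsol
      bd := (nice_Cl hlam nice ρ).1
      slow := slow_Cl hρ.le (slow u)
      hG := hGg ρ hρ hρr
      cl := fun t₁ ht₁ hz => hclose ε hε hεεa _ _ (nice_Cl hlam nice ρ) x y z (sx u) (sy u) s₀ t₁
        hsol (slow_Cl hρ.le (slow u)) hx0 hy0 hz0 hxP (by linarith [hs₀.1]) hz
      sx0 := sx0 u, sy0 := sy0 u
      neg := fun t ht => hma u (habsu.trans hδa') t ⟨hs₀.1.trans ht.1, ht.2⟩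
      hm := by linarith
      z0 := hz0
      hs := hsk
      hr := by
        have : M * (2 * κ + κ2) = M * (2 + cc) * κ := by rw [hkapdef]; ring
        linarith
      hμκ := by linarith
      hκκ := hκκ }
  have hsT : ∀ T1 ∈ Icc (-κ) κ2, s₀ ≤ T1 := fun T1 hT => by linarith [hT.1]
  refine ⟨O.y_ends.1, O.y_ends.2, ?_, ?_, ?_, ?_, ?_, ?_, ?_⟩
  · intro s hs t ht hst
    have := O.y_grow hs.1 hst.le ht.2
    have := mul_pos hg0 (sub_pos.2 hst)
    linarith
  · intro T1 hT hy hu'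
    exact (O.factA hT.1 hT.2 hy (hq' u ⟨hu.1, hu'⟩) (by linarith)).1
  · intro T1 hT hy hu'
    have := (O.factA hT.1 hT.2 hy (hq' u ⟨hu.1, by linarith⟩) (by linarith)).2
    linarith [(abs_le.1 this).2]
  · intro T1 hT hy hu'
    refine O.factC hT.1 hT.2 hy hu' hδ (η := η') (fun y z hy1 hy2 => ?_) ?_ (by linarith)
    · exact hm1.trans_le (hFf ρ hρ hρρ 0 y z (by simpa using hρ1.le) hy1 hy2)
    · have : M * (η' / g0) = M / g0 * η' := by ring
      linarith
  · intro T1 hT hy hu'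
    refine (le_max_left K' (r + 1)).trans ?_
    refine O.factB (c := c) (h := h) (m1 := m1) (ρ1 := ρ1) (η := η') hT.2 hT.1 hy hu' hc hcδ hcκ
      (hFf ρ hρ hρρ) hm1 hρ1 hη' (by linarith) hh h1.le (by linarith) (by linarith) (by linarith)
      ((lt_add_one r).trans_le (le_max_right _ _)) ?_
    have : 0 < max K' (r + 1) := lt_of_lt_of_le (by linarith) (le_max_right _ _)
    have h5 : max K' (r + 1) * 4 * ε ≤ max K' (r + 1) * 4 * εb := by gcongr
    linarith
  · intro T1 hT hy
    have hp : 0 < M * (-τ + 2) := mul_pos hM (by linarith)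
    refine O.z_lower (hsT T1 hT) (by linarith) (fun t ht => ?_)
    have h1 := O.spx s₀ t
    rw [abs_of_nonneg (by linarith [ht.1] : (0 : ℝ) ≤ t - s₀)] at h1
    have h3 : M * (t - s₀) ≤ M * (-τ + 2) :=
      mul_le_mul_of_nonneg_left (by linarith [ht.2, hT.2, hs₀.1]) hM.le
    linarith [(abs_le.1 h1).1, (abs_le.1 hxP).1]
  · intro T1 hT hy t ht hzt
    rcases le_or_gt t (-κ) with h | h
    · exact absurd hzt (O.z_neg t ⟨ht.1, h⟩).ne
    · have := (abs_le.1 (O.win t ⟨h.le, ht.2.trans hT.2⟩).1).1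
      linarith

end Canard
end

section

open Set Filter Topology

namespace Canard

lemma fixpt (N : ℝ × ℝ → ℝ × ℝ → ℝ × ℝ) (hN : ∀ q, Continuous fun w => N w q) {S : Set (ℝ × ℝ)}
    {β : ℝ} (hβ : 0 ≤ β)
    (lip : ∀ w ∈ S, ∀ q ∈ Metric.closedBall (0 : ℝ × ℝ) β, ∀ q' ∈ Metric.closedBall (0 : ℝ × ℝ) β,
      dist (N w q) (N w q') ≤ 1 / 2 * dist q q')
    (sm : ∀ w ∈ S, dist (N w 0) 0 ≤ β / 2) :
    ∃ Q : ℝ × ℝ → ℝ × ℝ, ContinuousOn Q S ∧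
      ∀ w ∈ S, Q w ∈ Metric.closedBall (0 : ℝ × ℝ) β ∧ N w (Q w) = Q w := by
  have h0 : (0 : ℝ × ℝ) ∈ Metric.closedBall (0 : ℝ × ℝ) β := by simpa using hβ
  have hex : ∀ w ∈ S, ∃ q ∈ Metric.closedBall (0 : ℝ × ℝ) β, N w q = q := by
    intro w hw
    have hmaps : MapsTo (N w) (Metric.closedBall (0 : ℝ × ℝ) β) (Metric.closedBall (0 : ℝ × ℝ) β) := by
      intro q hq
      have h1 := lip w hw q hq 0 h0
      have h2 := sm w hw
      rw [Metric.mem_closedBall] at hq ⊢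
      linarith [dist_triangle (N w q) (N w 0) 0]
    have hcon : ContractingWith (1 / 2) (hmaps.restrict (N w) _ _) := by
      refine ⟨by norm_num, LipschitzWith.of_dist_le_mul ?_⟩
      rintro ⟨q, hq⟩ ⟨q', hq'⟩
      have := lip w hw q hq q' hq'
      simpa [Subtype.dist_eq] using this
    obtain ⟨q, hq, hfix, -⟩ := hcon.exists_fixedPoint' (x := 0)
      Metric.isClosed_closedBall.isComplete hmaps h0 (edist_ne_top _ _)
    exact ⟨q, hq, hfix⟩
  choose! Q hQ1 hQ2 using hex
  refine ⟨Q, ?_, fun w hw => ⟨hQ1 w hw, hQ2 w hw⟩⟩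
  intro w₀ hw₀
  rw [ContinuousWithinAt, tendsto_iff_dist_tendsto_zero]
  have hlim : Tendsto (fun w => 2 * dist (N w (Q w₀)) (N w₀ (Q w₀))) (𝓝[S] w₀) (𝓝 0) := by
    have h1 : Tendsto (fun w => N w (Q w₀)) (𝓝[S] w₀) (𝓝 (N w₀ (Q w₀))) :=
      ((hN (Q w₀)).tendsto w₀).mono_left nhdsWithin_le_nhds
    have := (tendsto_iff_dist_tendsto_zero.1 h1).const_mul 2
    simpa using this
  refine squeeze_zero' (Eventually.of_forall fun w => dist_nonneg) ?_ hlim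
  filter_upwards [self_mem_nhdsWithin] with w hw
  have h1 := lip w hw _ (hQ1 w hw) _ (hQ1 w₀ hw₀)
  have h2 := dist_triangle (N w (Q w)) (N w (Q w₀)) (N w₀ (Q w₀))
  rw [hQ2 w hw, hQ2 w₀ hw₀] at h2
  rw [hQ2 w hw] at h1
  rw [hQ2 w₀ hw₀]
  linarith

/-- One-variable family with small derivative. -/
structure Fam (p p' : ℝ → ℝ → ℝ) : Prop where
  c : Continuous fun w : ℝ × ℝ => p w.1 w.2
  d : ∀ u b, HasDerivAt (p u) (p' u b) b
  c' : Continuous fun w : ℝ × ℝ => p' w.1 w.2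
  z : p' 0 0 = 0

lemma Fam.near {p p' : ℝ → ℝ → ℝ} (h : Fam p p') :
    ∀ᶠ r in 𝓝[>] (0 : ℝ), ∀ u, |u| ≤ r → ∀ b, |b| ≤ r → ∀ b', |b'| ≤ r →
      |p u b - p u b'| ≤ 1 / 4 * |b - b'| := by
  have h1 : ∀ᶠ w : ℝ × ℝ in 𝓝 (0, 0), |p' w.1 w.2| < 1 / 4 := by
    have := (h.c'.abs.tendsto (0, 0))
    simp only [h.z, abs_zero] at this
    exact this.eventually (gt_mem_nhds (by norm_num))
  obtain ⟨e, he, hball⟩ := Metric.eventually_nhds_iff.1 h1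
  filter_upwards [small 1 he] with r hr u hu b hb b' hb'
  have := Convex.norm_image_sub_le_of_norm_hasDerivWithin_le (f := p u) (f' := p' u)
    (s := Icc (-r) r) (x := b') (y := b) (C := 1 / 4) (fun r _ => (h.d u r).hasDerivWithinAt)
    (fun s hs => ?_) (convex_Icc _ _) (abs_le.1 hb') (abs_le.1 hb)
  · simpa using this
  · have hs' : |s| ≤ r := abs_le.2 hs
    refine (hball (y := (u, s)) ?_).le
    rw [Prod.dist_eq]
    simp only [Real.dist_eq, sub_zero]
    exact max_lt (by linarith) (by linarith)

lemma contract {p₁ p₁' q₁ q₁' p₂ p₂' q₂ q₂' : ℝ → ℝ → ℝ} (h1 : Fam p₁ p₁') (h2 : Fam q₁ q₁')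
    (h3 : Fam p₂ p₂') (h4 : Fam q₂ q₂') (z1 : p₁ 0 0 + q₁ 0 0 = 0) (z2 : p₂ 0 0 + q₂ 0 0 = 0)
    {β : ℝ} (hβ : 0 < β) : ∃ δ > 0, ∃ B C : ℝ × ℝ → ℝ,
      ContinuousOn B (Icc (-δ) δ ×ˢ Icc (-δ) δ) ∧ ContinuousOn C (Icc (-δ) δ ×ˢ Icc (-δ) δ) ∧
      ∀ w ∈ Icc (-δ) δ ×ˢ Icc (-δ) δ, |B w| ≤ β ∧ |C w| ≤ β ∧
        B w = p₁ w.1 (B w) + q₁ w.2 (C w) ∧ C w = p₂ w.1 (B w) + q₂ w.2 (C w) := by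
  obtain ⟨r, e1, e2, e3, e4, e5, hr : 0 < r⟩ := (h1.near.and (h2.near.and (h3.near.and
    (h4.near.and ((small 1 hβ).and eventually_mem_nhdsWithin))))).exists
  have near : ∀ᶠ w : ℝ × ℝ in 𝓝 (0, 0),
      |p₁ w.1 0 + q₁ w.2 0| < r / 2 ∧ |p₂ w.1 0 + q₂ w.2 0| < r / 2 := by
    have c1 : Continuous fun w : ℝ × ℝ => |p₁ w.1 0 + q₁ w.2 0| :=
      ((h1.c.comp (continuous_fst.prodMk continuous_const)).add
        (h2.c.comp (continuous_snd.prodMk continuous_const))).abs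
    have c2 : Continuous fun w : ℝ × ℝ => |p₂ w.1 0 + q₂ w.2 0| :=
      ((h3.c.comp (continuous_fst.prodMk continuous_const)).add
        (h4.c.comp (continuous_snd.prodMk continuous_const))).abs
    have t1 := c1.tendsto (0, 0)
    have t2 := c2.tendsto (0, 0)
    simp only [z1, z2, abs_zero] at t1 t2
    exact (t1.eventually (gt_mem_nhds (half_pos hr))).and
      (t2.eventually (gt_mem_nhds (half_pos hr)))
  obtain ⟨e, he, hball⟩ := Metric.eventually_nhds_iff.1 near
  have hδ : 0 < min r (e / 2) := lt_min hr (half_pos he)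
  set δ := min r (e / 2) with hδdef
  have key : ∀ w ∈ Icc (-δ) δ ×ˢ Icc (-δ) δ, |w.1| ≤ r ∧ |w.2| ≤ r ∧
      |p₁ w.1 0 + q₁ w.2 0| < r / 2 ∧ |p₂ w.1 0 + q₂ w.2 0| < r / 2 := by
    rintro ⟨u, v⟩ ⟨hu, hv⟩
    have hu' : |u| ≤ δ := abs_le.2 hu
    have hv' : |v| ≤ δ := abs_le.2 hv
    have d1 : δ ≤ r := min_le_left _ _
    have d2 : δ ≤ e / 2 := min_le_right _ _
    refine ⟨hu'.trans d1, hv'.trans d1, hball ?_⟩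
    rw [Prod.dist_eq]
    simp only [Real.dist_eq, sub_zero]
    exact max_lt (by linarith) (by linarith)
  obtain ⟨Q, hQc, hQ⟩ := fixpt
    (fun w q => (p₁ w.1 q.1 + q₁ w.2 q.2, p₂ w.1 q.1 + q₂ w.2 q.2))
    (fun q => ((h1.c.comp (continuous_fst.prodMk continuous_const)).add
        (h2.c.comp (continuous_snd.prodMk continuous_const))).prodMk
        ((h3.c.comp (continuous_fst.prodMk continuous_const)).add
        (h4.c.comp (continuous_snd.prodMk continuous_const))))
    (S := Icc (-δ) δ ×ˢ Icc (-δ) δ) (β := r) hr.le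
    (by
      intro w hw q hq q' hq'
      obtain ⟨k1, k2, -, -⟩ := key w hw
      have b1 : |q.1| ≤ r ∧ |q.2| ≤ r := by
        rw [Metric.mem_closedBall, dist_zero_right] at hq
        exact ⟨(norm_fst_le q).trans hq, (norm_snd_le q).trans hq⟩
      have b2 : |q'.1| ≤ r ∧ |q'.2| ≤ r := by
        rw [Metric.mem_closedBall, dist_zero_right] at hq'
        exact ⟨(norm_fst_le q').trans hq', (norm_snd_le q').trans hq'⟩
      have f1 := e1 _ k1 _ b1.1 _ b2.1
      have f2 := e2 _ k2 _ b1.2 _ b2.2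
      have f3 := e3 _ k1 _ b1.1 _ b2.1
      have f4 := e4 _ k2 _ b1.2 _ b2.2
      have d1 : |q.1 - q'.1| ≤ dist q q' := by
        rw [Prod.dist_eq]; exact le_max_left _ _
      have d2 : |q.2 - q'.2| ≤ dist q q' := by
        rw [Prod.dist_eq]; exact le_max_right _ _
      rw [Prod.dist_eq]
      simp only [Real.dist_eq]
      refine max_le ?_ ?_
      · rw [add_sub_add_comm]
        exact (abs_add_le _ _).trans (by linarith)
      · rw [add_sub_add_comm]
        exact (abs_add_le _ _).trans (by linarith))
    (by
      intro w hw
      obtain ⟨-, -, k3, k4⟩ := key w hw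
      rw [Prod.dist_eq]
      simp only [Prod.fst_zero, Prod.snd_zero, Real.dist_eq, sub_zero]
      exact max_le k3.le k4.le)
  refine ⟨δ, hδ, fun w => (Q w).1, fun w => (Q w).2, continuous_fst.comp_continuousOn hQc,
    continuous_snd.comp_continuousOn hQc, fun w hw => ?_⟩
  obtain ⟨hq, hfix⟩ := hQ w hw
  rw [Metric.mem_closedBall, dist_zero_right] at hq
  refine ⟨((norm_fst_le (Q w)).trans hq).trans (by linarith),
    ((norm_snd_le (Q w)).trans hq).trans (by linarith), ?_, ?_⟩
  · exact (congrArg Prod.fst hfix).symm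
  · exact (congrArg Prod.snd hfix).symm

/-- Intersection of the two families of slow orbits. -/
lemma implicit {ax ay rx ry ax' ay' rx' ry' : ℝ → ℝ → ℝ} {τ σ : ℝ}
    (cax : Continuous fun w : ℝ × ℝ => ax w.1 w.2) (cay : Continuous fun w : ℝ × ℝ => ay w.1 w.2)
    (crx : Continuous fun w : ℝ × ℝ => rx w.1 w.2) (cry : Continuous fun w : ℝ × ℝ => ry w.1 w.2)
    (cax' : Continuous fun w : ℝ × ℝ => ax' w.1 w.2) (cay' : Continuous fun w : ℝ × ℝ => ay' w.1 w.2)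
    (crx' : Continuous fun w : ℝ × ℝ => rx' w.1 w.2) (cry' : Continuous fun w : ℝ × ℝ => ry' w.1 w.2)
    (dax : ∀ u t, HasDerivAt (ax u) (ax' u t) t) (day : ∀ u t, HasDerivAt (ay u) (ay' u t) t)
    (drx : ∀ u t, HasDerivAt (rx u) (rx' u t) t) (dry : ∀ u t, HasDerivAt (ry u) (ry' u t) t)
    (ex : ax 0 τ = rx 0 σ) (ey : ay 0 τ = ry 0 σ)
    (hdet : ax' 0 τ * ry' 0 σ - rx' 0 σ * ay' 0 τ ≠ 0) {β : ℝ} (hβ : 0 < β) :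
    ∃ δ > 0, ∃ B C : ℝ × ℝ → ℝ,
      ContinuousOn B (Icc (-δ) δ ×ˢ Icc (-δ) δ) ∧ ContinuousOn C (Icc (-δ) δ ×ˢ Icc (-δ) δ) ∧
      ∀ w ∈ Icc (-δ) δ ×ˢ Icc (-δ) δ, |B w| ≤ β ∧ |C w| ≤ β ∧
        ax w.1 (τ + B w) = rx w.2 (σ + C w) ∧ ay w.1 (τ + B w) = ry w.2 (σ + C w) := by
  set A1 := ax' 0 τ
  set A2 := ay' 0 τ
  set R1 := rx' 0 σ
  set R2 := ry' 0 σ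
  set D := A1 * R2 - R1 * A2 with hD
  have sh : ∀ {k : ℝ → ℝ → ℝ} (c : ℝ), Continuous (fun w : ℝ × ℝ => k w.1 w.2) →
      Continuous fun w : ℝ × ℝ => k w.1 (c + w.2) := by
    intro k c hk
    exact hk.comp (continuous_fst.prodMk (continuous_const.add continuous_snd))
  have dsh : ∀ {k k' : ℝ → ℝ → ℝ} (c : ℝ), (∀ u t, HasDerivAt (k u) (k' u t) t) →
      ∀ u b, HasDerivAt (fun b => k u (c + b)) (k' u (c + b)) b := by
    intro k k' c hk u b
    exact HasDerivAt.comp_const_add c b (hk u (c + b))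
  have cc1 := sh τ cax
  have cc2 := sh τ cay
  have cc3 := sh σ crx
  have cc4 := sh σ cry
  have cc5 := sh τ cax'
  have cc6 := sh τ cay'
  have cc7 := sh σ crx'
  have cc8 := sh σ cry'
  have h1 : Fam (fun u b => b - (R2 * ax u (τ + b) - R1 * ay u (τ + b)) / D)
      (fun u b => 1 - (R2 * ax' u (τ + b) - R1 * ay' u (τ + b)) / D) :=
    ⟨by fun_prop, fun u b => (hasDerivAt_id b).sub ((((dsh τ dax u b).const_mul R2).sub
      ((dsh τ day u b).const_mul R1)).div_const D), by fun_prop, by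
        simp only [add_zero]
        change 1 - (R2 * A1 - R1 * A2) / D = 0
        rw [mul_comm R2, ← hD, div_self hdet, sub_self]⟩
  have h2 : Fam (fun v c => (R2 * rx v (σ + c) - R1 * ry v (σ + c)) / D)
      (fun v c => (R2 * rx' v (σ + c) - R1 * ry' v (σ + c)) / D) :=
    ⟨by fun_prop, fun u b => (((dsh σ drx u b).const_mul R2).sub
      ((dsh σ dry u b).const_mul R1)).div_const D, by fun_prop, by
        simp only [add_zero]
        change (R2 * R1 - R1 * R2) / D = 0
        rw [mul_comm R2, sub_self, zero_div]⟩
  have h3 : Fam (fun u b => - (A2 * ax u (τ + b) - A1 * ay u (τ + b)) / D)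
      (fun u b => - (A2 * ax' u (τ + b) - A1 * ay' u (τ + b)) / D) :=
    ⟨by fun_prop, fun u b => ((((dsh τ dax u b).const_mul A2).sub
      ((dsh τ day u b).const_mul A1)).neg.div_const D), by fun_prop, by
        simp only [add_zero]
        change - (A2 * A1 - A1 * A2) / D = 0
        rw [mul_comm A2, sub_self, neg_zero, zero_div]⟩
  have h4 : Fam (fun v c => c + (A2 * rx v (σ + c) - A1 * ry v (σ + c)) / D)
      (fun v c => 1 + (A2 * rx' v (σ + c) - A1 * ry' v (σ + c)) / D) :=
    ⟨by fun_prop, fun u b => (hasDerivAt_id b).add ((((dsh σ drx u b).const_mul A2).sub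
      ((dsh σ dry u b).const_mul A1)).div_const D), by fun_prop, by
        simp only [add_zero]
        change 1 + (A2 * R1 - A1 * R2) / D = 0
        have : A2 * R1 - A1 * R2 = -D := by rw [hD]; ring
        rw [this, neg_div, div_self hdet]; ring⟩
  obtain ⟨δ, hδ, B, C, hB, hC, hBC⟩ := contract h1 h2 h3 h4
    (by simp only [add_zero, ex, ey]; ring) (by simp only [add_zero, ex, ey]; ring) hβ
  refine ⟨δ, hδ, B, C, hB, hC, fun w hw => ?_⟩
  obtain ⟨k1, k2, k3, k4⟩ := hBC w hw
  refine ⟨k1, k2, ?_⟩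
  generalize ax w.1 (τ + B w) = a1 at *
  generalize ay w.1 (τ + B w) = a2 at *
  generalize rx w.2 (σ + C w) = r1 at *
  generalize ry w.2 (σ + C w) = r2 at *
  have m1 : R2 * (a1 - r1) - R1 * (a2 - r2) = 0 := by
    have : (R2 * (a1 - r1) - R1 * (a2 - r2)) / D = 0 := by
      linear_combination k3
    simpa [hdet] using this
  have m2 : A2 * (a1 - r1) - A1 * (a2 - r2) = 0 := by
    have : (A2 * (a1 - r1) - A1 * (a2 - r2)) / D = 0 := by
      linear_combination k4
    simpa [hdet] using this
  constructor
  · have : D * (a1 - r1) = 0 := by rw [hD]; linear_combination A1 * m1 - R1 * m2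
    rcases mul_eq_zero.1 this with h | h
    · exact absurd h hdet
    · linarith
  · have : D * (a2 - r2) = 0 := by rw [hD]; linear_combination A2 * m1 - R2 * m2
    rcases mul_eq_zero.1 this with h | h
    · exact absurd h hdet
    · linarith

end Canard
end

section

open Set Filter Topology

namespace Canard

lemma clamp_upper {x z : ℝ → ℝ} {ε M ρ T : ℝ} (hε : 0 < ε) (hT : 0 < T)
    (hMρ : M * ε < ρ) (hx : ∀ s t, |x t - x s| ≤ M * |t - s|)
    (hz : ∀ t, HasDerivAt z ((x t + |z t|) / ε) t)
    (px : ∀ t, x (t + T) = x t) (pz : ∀ t, z (t + T) = z t) : ∀ t, z t ≤ |x t| + ρ := by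
  have hM : 0 ≤ M := by
    have := hx 0 1
    simp at this
    exact (abs_nonneg _).trans this
  have hρ : 0 < ρ := lt_of_le_of_lt (by positivity) hMρ
  have cx : Continuous x := by
    refine (LipschitzWith.of_dist_le_mul (K := ⟨M, hM⟩) fun s t => ?_).continuous
    exact hx t s
  have cz : Continuous z := continuous_iff_continuousAt.2 fun t => (hz t).continuousAt
  set w : ℝ → ℝ := fun t => z t - |x t| with hw
  have cw : Continuous w := cz.sub cx.abs
  have pw : Function.Periodic w T := fun t => by simp only [hw, px, pz]
  have hcomp : IsCompact (range w) := pw.compact_of_continuous hT.ne' cw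
  obtain ⟨-, ⟨⟨t, rfl⟩, hmax⟩⟩ := hcomp.exists_isGreatest (range_nonempty w)
  have hmax' : ∀ s, w s ≤ w t := fun s => hmax (mem_range_self s)
  by_cases hwt : w t ≤ ρ
  · intro s
    have := (hmax' s).trans hwt
    simp only [hw] at this
    linarith
  · exfalso
    push Not at hwt
    have hev : ∀ᶠ s in 𝓝 t, ρ < w s := (cw.tendsto t).eventually (lt_mem_nhds hwt)
    obtain ⟨e, he, hball⟩ := Metric.eventually_nhds_iff.1 hev
    have hg := growth (φ := z) (a := t) (b := t + e / 2) (c := ρ / ε) (by linarith) hz (fun s hs => by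
      have h1 : ρ < w s := hball (by
        rw [Real.dist_eq, abs_lt]; constructor <;> linarith [hs.1, hs.2])
      simp only [hw] at h1
      have h2 := le_abs_self (z s)
      have h3 := neg_abs_le (x s)
      exact div_le_div_of_nonneg_right (by linarith) hε.le)
    have h4 := hmax' (t + e / 2)
    have h5 := hx t (t + e / 2)
    have h6 := abs_abs_sub_abs_le_abs_sub (x (t + e / 2)) (x t)
    have h7 := le_abs_self (|x (t + e / 2)| - |x t|)
    rw [show t + e / 2 - t = e / 2 by ring] at h5 hg
    rw [abs_of_pos (by linarith : 0 < e / 2)] at h5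
    simp only [hw] at h4
    have h8 : M * (e / 2) < ρ / ε * (e / 2) := by
      apply mul_lt_mul_of_pos_right _ (by linarith)
      rwa [lt_div_iff₀ hε]
    linarith

lemma clamp_both {x z : ℝ → ℝ} {ε M ρ T : ℝ} (hε : 0 < ε) (hT : 0 < T)
    (hMρ : M * ε < ρ) (hx : ∀ s t, |x t - x s| ≤ M * |t - s|)
    (hz : ∀ t, HasDerivAt z ((x t + |z t|) / ε) t)
    (px : ∀ t, x (t + T) = x t) (pz : ∀ t, z (t + T) = z t) : ∀ t, |z t| ≤ |x t| + ρ := by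
  intro t
  rw [abs_le']
  refine ⟨clamp_upper hε hT hMρ hx hz px pz t, ?_⟩
  have := clamp_upper (x := fun t => x (-t)) (z := fun t => - z (-t)) hε hT hMρ
    (fun s t => by
      have := hx (-s) (-t)
      rwa [show -t - -s = -(t - s) by ring, abs_neg] at this)
    (fun t => by
      refine ((hz (-t)).scomp t (hasDerivAt_neg t)).neg.congr_deriv ?_
      simp)
    (fun t => by
      have := px (-(t + T))
      rw [show -(t + T) + T = -t by ring] at this
      exact this.symm)
    (fun t => by
      have := pz (-(t + T))
      rw [show -(t + T) + T = -t by ring] at this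
      simp only [this]) (-t)
  simpa using this

/-- Continuity of the hitting time. -/
lemma hitting {W : Type*} [TopologicalSpace W] {Y : W → ℝ → ℝ}
    (hY : Continuous fun p : W × ℝ => Y p.1 p.2) {a b : ℝ} (hab : -a ≤ b)
    (mono : ∀ w, StrictMonoOn (Y w) (Icc (-a) b)) (ha : ∀ w, Y w (-a) < 0) (hb : ∀ w, 0 < Y w b) :
    ∃ T : W → ℝ, Continuous T ∧ ∀ w, T w ∈ Icc (-a) b ∧ Y w (T w) = 0 := by
  have cw : ∀ w, Continuous (Y w) := fun w => hY.comp (continuous_const.prodMk continuous_id)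
  have ct : ∀ t, Continuous fun w => Y w t := fun t => hY.comp (continuous_id.prodMk continuous_const)
  have hex : ∀ w, ∃ t ∈ Icc (-a) b, Y w t = 0 := by
    intro w
    exact intermediate_value_Icc hab (cw w).continuousOn ⟨(ha w).le, (hb w).le⟩
  choose T hT hT0 using hex
  refine ⟨T, ?_, fun w => ⟨hT w, hT0 w⟩⟩
  rw [continuous_iff_continuousAt]
  intro w₀
  rw [ContinuousAt, Metric.tendsto_nhds]
  intro e he
  have hlo : -a < T w₀ := lt_of_le_of_ne (hT w₀).1 (fun h => by
    have := ha w₀; rw [h, hT0] at this; exact lt_irrefl _ this)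
  have hhi : T w₀ < b := lt_of_le_of_ne (hT w₀).2 (fun h => by
    have := hb w₀; rw [← h, hT0] at this; exact lt_irrefl _ this)
  set t1 := max (T w₀ - e / 2) (-a) with ht1
  set t2 := min (T w₀ + e / 2) b with ht2
  have l1 : t1 < T w₀ := max_lt (by linarith) hlo
  have l2 : T w₀ < t2 := lt_min (by linarith) hhi
  have i1 : t1 ∈ Icc (-a) b := ⟨le_max_right _ _, (l1.trans hhi).le⟩
  have i2 : t2 ∈ Icc (-a) b := ⟨(hlo.trans l2).le, min_le_right _ _⟩
  have s1 : Y w₀ t1 < 0 := by rw [← hT0 w₀]; exact mono w₀ i1 (hT w₀) l1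
  have s2 : 0 < Y w₀ t2 := by rw [← hT0 w₀]; exact mono w₀ (hT w₀) i2 l2
  filter_upwards [((ct t1).tendsto w₀).eventually (gt_mem_nhds s1),
    ((ct t2).tendsto w₀).eventually (lt_mem_nhds s2)] with w k1 k2
  have j1 : t1 < T w := by
    by_contra h
    push Not at h
    have := (mono w).monotoneOn (hT w) i1 h
    rw [hT0] at this
    linarith
  have j2 : T w < t2 := by
    by_contra h
    push Not at h
    have := (mono w).monotoneOn i2 (hT w) h
    rw [hT0] at this
    linarith
  have m1 : T w₀ - e / 2 ≤ t1 := le_max_left _ _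
  have m2 : t2 ≤ T w₀ + e / 2 := min_le_left _ _
  rw [Real.dist_eq, abs_lt]
  constructor <;> linarith

/-- The full vector field. -/
noncomputable def field (F G : ℝ → ℝ → ℝ → ℝ) (ε : ℝ) (p : ℝ × ℝ × ℝ) : ℝ × ℝ × ℝ :=
  (F p.1 p.2.1 p.2.2, G p.1 p.2.1 p.2.2, (p.1 + |p.2.2|) / ε)

lemma lip3 {F G : ℝ → ℝ → ℝ → ℝ} {M L ε : ℝ} (hL : 0 ≤ L) (hε : 0 < ε) (hN : Nice F G M L) :
    ∃ K, LipschitzWith K (field F G ε) := by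
  have hK : 0 ≤ 3 * L + 2 / ε := by positivity
  refine ⟨⟨3 * L + 2 / ε, hK⟩, LipschitzWith.of_dist_le_mul ?_⟩
  rintro ⟨x, y, z⟩ ⟨x', y', z'⟩
  change dist _ _ ≤ (3 * L + 2 / ε) * dist _ _
  obtain ⟨-, h1, h2⟩ := hN
  set d := dist (x, y, z) (x', y', z') with hd
  have d0 : 0 ≤ d := dist_nonneg
  have d1 : |x - x'| ≤ d := by rw [hd, Prod.dist_eq]; exact le_max_left _ _
  have d2 : |y - y'| ≤ d := by
    rw [hd, Prod.dist_eq, Prod.dist_eq]; exact (le_max_left _ _).trans (le_max_right _ _)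
  have d3 : |z - z'| ≤ d := by
    rw [hd, Prod.dist_eq, Prod.dist_eq]; exact (le_max_right _ _).trans (le_max_right _ _)
  have e1 := h1 x y z x' y' z'
  have e2 := h2 x y z x' y' z'
  have e3 : L * (|x - x'| + |y - y'| + |z - z'|) ≤ L * (3 * d) :=
    mul_le_mul_of_nonneg_left (by linarith) hL
  have e4 : 0 ≤ 2 / ε * d := by positivity
  have e5 : |(x + |z|) / ε - (x' + |z'|) / ε| ≤ 2 / ε * d := by
    rw [← sub_div, abs_div, abs_of_pos hε, div_le_iff₀ hε]
    have : 2 / ε * d * ε = 2 * d := by field_simp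
    rw [this, add_sub_add_comm]
    have := abs_abs_sub_abs_le_abs_sub z z'
    exact (abs_add_le _ _).trans (by linarith)
  have e6 : 0 ≤ L * d := by positivity
  rw [field, field, Prod.dist_eq, Prod.dist_eq]
  simp only [Real.dist_eq]
  refine max_le (by linarith) (max_le (by linarith) (by linarith))

lemma sol_iff {F G : ℝ → ℝ → ℝ → ℝ} {ε : ℝ} {x y z : ℝ → ℝ} (h : Sol F G ε x y z) (t : ℝ) :
    HasDerivAt (fun t => (x t, y t, z t)) (field F G ε (x t, y t, z t)) t :=
  (h.1 t).prodMk ((h.2.1 t).prodMk (h.2.2 t))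

lemma full_flow {F G : ℝ → ℝ → ℝ → ℝ} {M L ε : ℝ} (hL : 0 ≤ L) (hε : 0 < ε) (hN : Nice F G M L) :
    ∃ Φ : ℝ → ℝ × ℝ × ℝ → ℝ × ℝ × ℝ, (∀ p, Φ 0 p = p) ∧
      (∀ p, Sol F G ε (fun t => (Φ t p).1) (fun t => (Φ t p).2.1) (fun t => (Φ t p).2.2)) ∧
      Continuous (fun q : ℝ × (ℝ × ℝ × ℝ) => Φ q.1 q.2) := by
  obtain ⟨K, hK⟩ := lip3 hL hε hN
  obtain ⟨Φ, h0, h1, h2⟩ := exists_flow _ K hK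
  refine ⟨Φ, h0, fun p => ⟨fun t => ?_, fun t => ?_, fun t => ?_⟩, h2⟩
  · exact ((hasFDerivAt_fst (p := Φ t p)).comp_hasDerivAt t (h1 p t))
  · exact ((hasFDerivAt_fst (p := (Φ t p).2)).comp_hasDerivAt t
      ((hasFDerivAt_snd (p := Φ t p)).comp_hasDerivAt t (h1 p t)))
  · exact ((hasFDerivAt_snd (p := (Φ t p).2)).comp_hasDerivAt t
      ((hasFDerivAt_snd (p := Φ t p)).comp_hasDerivAt t (h1 p t)))

lemma full_unique {F G : ℝ → ℝ → ℝ → ℝ} {M L ε : ℝ} (hL : 0 ≤ L) (hε : 0 < ε) (hN : Nice F G M L)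
    {x y z x' y' z' : ℝ → ℝ} (h : Sol F G ε x y z) (h' : Sol F G ε x' y' z') {s : ℝ}
    (hx : x s = x' s) (hy : y s = y' s) (hz : z s = z' s) (t : ℝ) :
    x t = x' t ∧ y t = y' t ∧ z t = z' t := by
  obtain ⟨K, hK⟩ := lip3 hL hε hN
  have := sol_unique _ K hK (sol_iff h) (sol_iff h') (s := s) (by simp only [hx, hy, hz])
  have := congrFun this t
  simpa using this

lemma sol_shift {F G : ℝ → ℝ → ℝ → ℝ} {ε : ℝ} {x y z : ℝ → ℝ} (h : Sol F G ε x y z) (c : ℝ) :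
    Sol F G ε (fun t => x (t + c)) (fun t => y (t + c)) (fun t => z (t + c)) :=
  ⟨fun t => (h.1 (t + c)).comp_add_const t c, fun t => (h.2.1 (t + c)).comp_add_const t c,
    fun t => (h.2.2 (t + c)).comp_add_const t c⟩

/-- The slow vector field. -/
def sfield (F G : ℝ → ℝ → ℝ → ℝ) (p : ℝ × ℝ) : ℝ × ℝ := (F p.1 p.2 p.1, G p.1 p.2 p.1)

lemma lip2 {F G : ℝ → ℝ → ℝ → ℝ} {M L : ℝ} (hL : 0 ≤ L) (hN : Nice F G M L) :
    ∃ K, LipschitzWith K (sfield F G) := by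
  have hK : 0 ≤ 3 * L := by positivity
  refine ⟨⟨3 * L, hK⟩, LipschitzWith.of_dist_le_mul ?_⟩
  rintro ⟨x, y⟩ ⟨x', y'⟩
  change dist _ _ ≤ (3 * L) * dist _ _
  obtain ⟨-, h1, h2⟩ := hN
  set d := dist (x, y) (x', y') with hd
  have d1 : |x - x'| ≤ d := by rw [hd, Prod.dist_eq]; exact le_max_left _ _
  have d2 : |y - y'| ≤ d := by rw [hd, Prod.dist_eq]; exact le_max_right _ _
  have e1 := h1 x y x x' y' x'
  have e2 := h2 x y x x' y' x'
  have e3 : L * (|x - x'| + |y - y'| + |x - x'|) ≤ L * (3 * d) :=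
    mul_le_mul_of_nonneg_left (by linarith) hL
  rw [sfield, sfield, Prod.dist_eq]
  simp only [Real.dist_eq]
  exact max_le (by linarith) (by linarith)

lemma slow_flow {F G : ℝ → ℝ → ℝ → ℝ} {M L : ℝ} (hL : 0 ≤ L) (hN : Nice F G M L) :
    ∃ sx sy : ℝ → ℝ → ℝ, (∀ u, Slow F G (sx u) (sy u)) ∧ (∀ u, sx u 0 = u) ∧ (∀ u, sy u 0 = 0) ∧
      Continuous (fun p : ℝ × ℝ => sx p.1 p.2) ∧ Continuous (fun p : ℝ × ℝ => sy p.1 p.2) := by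
  obtain ⟨K, hK⟩ := lip2 hL hN
  obtain ⟨Φ, h0, h1, h2⟩ := exists_flow _ K hK
  have hc : Continuous fun p : ℝ × ℝ => Φ p.2 (p.1, 0) :=
    h2.comp (continuous_snd.prodMk (continuous_fst.prodMk continuous_const))
  refine ⟨fun u t => (Φ t (u, 0)).1, fun u t => (Φ t (u, 0)).2, fun u => ⟨fun t => ?_, fun t => ?_⟩,
    fun u => by simp only [h0], fun u => by simp only [h0], hc.fst, hc.snd⟩
  · exact ((hasFDerivAt_fst (p := Φ t (u, 0))).comp_hasDerivAt t (h1 _ t))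
  · exact ((hasFDerivAt_snd (p := Φ t (u, 0))).comp_hasDerivAt t (h1 _ t))

lemma slow_unique {F G : ℝ → ℝ → ℝ → ℝ} {M L : ℝ} (hL : 0 ≤ L) (hN : Nice F G M L)
    {x y x' y' : ℝ → ℝ} (h : Slow F G x y) (h' : Slow F G x' y') {s : ℝ}
    (hx : x s = x' s) (hy : y s = y' s) (t : ℝ) : x t = x' t ∧ y t = y' t := by
  obtain ⟨K, hK⟩ := lip2 hL hN
  have := sol_unique (sfield F G) K hK (x := fun t => (x t, y t)) (y := fun t => (x' t, y' t))
    (fun t => (h.1 t).prodMk (h.2 t)) (fun t => (h'.1 t).prodMk (h'.2 t)) (s := s)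
    (by simp only [hx, hy])
  have := congrFun this t
  simpa using this

/-- Reflected system. -/
def rf (f : ℝ → ℝ → ℝ → ℝ) (x y z : ℝ) : ℝ := - f x (-y) (-z)

/-- Reflected system, second component. -/
def rg (g : ℝ → ℝ → ℝ → ℝ) (x y z : ℝ) : ℝ := g x (-y) (-z)

lemma nice_refl {f g : ℝ → ℝ → ℝ → ℝ} {M L : ℝ} (h : Nice f g M L) : Nice (rf f) (rg g) M L := by
  obtain ⟨h1, h2, h3⟩ := h
  refine ⟨fun x y z => ⟨?_, (h1 _ _ _).2⟩, fun x₁ y₁ z₁ x₂ y₂ z₂ => ?_, fun x₁ y₁ z₁ x₂ y₂ z₂ => ?_⟩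
  · rw [rf, abs_neg]; exact (h1 _ _ _).1
  · have := h2 x₁ (-y₁) (-z₁) x₂ (-y₂) (-z₂)
    rw [neg_sub_neg, neg_sub_neg, abs_sub_comm y₂, abs_sub_comm z₂] at this
    rw [rf, rf, neg_sub_neg, abs_sub_comm]
    exact this
  · have := h3 x₁ (-y₁) (-z₁) x₂ (-y₂) (-z₂)
    rw [neg_sub_neg, neg_sub_neg, abs_sub_comm y₂, abs_sub_comm z₂] at this
    exact this

lemma sol_refl {f g : ℝ → ℝ → ℝ → ℝ} {ε ρ : ℝ} {x y z : ℝ → ℝ} (hρ : 0 ≤ ρ)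
    (h : Sol (Cl f ρ) (Cl g ρ) ε x y z) :
    Sol (Cl (rf f) ρ) (Cl (rg g) ρ) ε (fun t => x (-t)) (fun t => - y (-t)) (fun t => - z (-t)) := by
  refine ⟨fun t => ?_, fun t => ?_, fun t => ?_⟩
  · refine ((h.1 (-t)).scomp t (hasDerivAt_neg t)).congr_deriv ?_
    simp only [Cl, rf, clp_neg hρ, neg_neg]
    simp
  · refine ((h.2.1 (-t)).scomp t (hasDerivAt_neg t)).neg.congr_deriv ?_
    simp only [Cl, rg, clp_neg hρ, neg_neg]
    simp
  · refine ((h.2.2 (-t)).scomp t (hasDerivAt_neg t)).neg.congr_deriv ?_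
    simp

end Canard
end

section

open Set Filter Topology

namespace Canard

/-- Periodic solution with minimal period `T`. -/
def Per (f g : ℝ → ℝ → ℝ → ℝ) (ε : ℝ) (x y z : ℝ → ℝ) (T : ℝ) : Prop :=
  (∀ t : ℝ, HasDerivAt x (f (x t) (y t) (z t)) t) ∧
  (∀ t : ℝ, HasDerivAt y (g (x t) (y t) (z t)) t) ∧
  (∀ t : ℝ, HasDerivAt z ((x t + |z t|) / ε) t) ∧
  (∃ s t : ℝ, ¬ (x s = x t ∧ y s = y t ∧ z s = z t)) ∧
  0 < T ∧
  (∀ t : ℝ, x (t + T) = x t ∧ y (t + T) = y t ∧ z (t + T) = z t) ∧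
  (∀ T' : ℝ, 0 < T' →
    (∀ t : ℝ, x (t + T') = x t ∧ y (t + T') = y t ∧ z (t + T') = z t) → T ≤ T')

lemma match_eta {f g : ℝ → ℝ → ℝ → ℝ} {M lam Ta τ Tr σ : ℝ} {sx sy sx2 sy2 : ℝ → ℝ → ℝ}
    (D1 : Data f g M lam Ta τ sx sy) (D2 : Data (rf f) (rg g) M lam Tr (-σ) sx2 sy2)
    (csy : Continuous fun p : ℝ × ℝ => sy p.1 p.2) (hxs : sx2 0 (-σ) = sx 0 τ)
    (himp : ∀ β > 0, ∃ δ > 0, ∃ B C : ℝ × ℝ → ℝ,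
      ContinuousOn B (Icc (-δ) δ ×ˢ Icc (-δ) δ) ∧ ContinuousOn C (Icc (-δ) δ ×ˢ Icc (-δ) δ) ∧
      ∀ w ∈ Icc (-δ) δ ×ˢ Icc (-δ) δ, |B w| ≤ β ∧ |C w| ≤ β ∧
        sx w.1 (τ + B w) = sx2 w.2 (-(σ + C w)) ∧ sy w.1 (τ + B w) = - sy2 w.2 (-(σ + C w)))
    {η : ℝ} (hη : 0 < η) :
    ∃ ε0 > 0, ∀ ε, 0 < ε → ε < ε0 → ∃ x y z : ℝ → ℝ, ∃ T : ℝ, Per f g ε x y z T ∧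
      |T - (σ - τ)| ≤ 4 * η := by
  have hM := D1.hM
  have hlam := D1.hlam
  have hL : 0 ≤ 2 * lam + 1 := by linarith
  obtain ⟨K1, H1⟩ := half D1
  obtain ⟨K2, H2⟩ := half D2
  obtain ⟨β1, hβ1, a1, ha1, b1, hb1, hβη1, haη1, hbη1, hτ1, δ1, hδ1, hxs1, H1⟩ := H1 η hη
  obtain ⟨β2, hβ2, a2, ha2, b2, hb2, hβη2, haη2, hbη2, hτ2, δ2, hδ2, hxs2, H2⟩ := H2 η hη
  obtain ⟨δ3, hδ3, B, C, hB, hC, hBC⟩ := himp (min β1 β2) (lt_min hβ1 hβ2)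
  have hδ : 0 < min (min δ1 δ2) δ3 := lt_min (lt_min hδ1 hδ2) hδ3
  set δ := min (min δ1 δ2) δ3
  have hδδ1 : δ ≤ δ1 := (min_le_left _ _).trans (min_le_left _ _)
  have hδδ2 : δ ≤ δ2 := (min_le_left _ _).trans (min_le_right _ _)
  have hδδ3 : δ ≤ δ3 := min_le_right _ _
  obtain ⟨ρ1, hρ1, H1⟩ := H1 δ hδ hδδ1
  obtain ⟨ρ2, hρ2, H2⟩ := H2 δ hδ hδδ2
  have hρ : 0 < min ρ1 ρ2 := lt_min hρ1 hρ2
  set ρ := min ρ1 ρ2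
  obtain ⟨ε1, hε1, H1⟩ := H1 ρ hρ (min_le_left _ _) (|K1| + |K2| + 1)
  obtain ⟨ε2, hε2, H2⟩ := H2 ρ hρ (min_le_right _ _) (|K1| + |K2| + 1)
  refine ⟨min (min ε1 ε2) (ρ / M), lt_min (lt_min hε1 hε2) (by positivity), fun ε hε hεlt => ?_⟩
  have hεε1 : ε < ε1 := hεlt.trans_le ((min_le_left _ _).trans (min_le_left _ _))
  have hεε2 : ε < ε2 := hεlt.trans_le ((min_le_left _ _).trans (min_le_right _ _))
  have hMρ : M * ε < ρ := by
    have : ε < ρ / M := hεlt.trans_le (min_le_right _ _)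
    rw [lt_div_iff₀ hM] at this
    linarith
  have niceC := nice_Cl hlam D1.nice ρ
  obtain ⟨Φ, Φ0, Φsol, Φc⟩ := full_flow hL hε niceC
  -- projection to the square
  set pr : ℝ → ℝ := fun u => max (-δ) (min δ u) with hpr
  have prc : Continuous pr := by fun_prop
  have prm : ∀ u, pr u ∈ Icc (-δ) δ := fun u =>
    ⟨le_max_left _ _, max_le (by linarith) (min_le_left _ _)⟩
  have pre : ∀ u ∈ Icc (-δ) δ, pr u = u := fun u hu => by
    simp only [hpr]; rw [min_eq_right hu.2, max_eq_right hu.1]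
  set π : ℝ × ℝ → ℝ × ℝ := fun w => (pr w.1, pr w.2) with hπ
  have πc : Continuous π := by fun_prop
  have hsub : Icc (-δ) δ ⊆ Icc (-δ3) δ3 := Icc_subset_Icc (by linarith) hδδ3
  have πm : ∀ w, π w ∈ Icc (-δ3) δ3 ×ˢ Icc (-δ3) δ3 := fun w => ⟨hsub (prm _), hsub (prm _)⟩
  set b : ℝ × ℝ → ℝ := fun w => τ + B (π w) with hb
  set c : ℝ × ℝ → ℝ := fun w => σ + C (π w) with hc
  have bc : Continuous b := continuous_const.add (hB.comp_continuous πc πm)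
  have cc : Continuous c := continuous_const.add (hC.comp_continuous πc πm)
  have bm : ∀ w, b w ∈ Icc (τ - β1) (τ + β1) := by
    intro w
    have := (hBC _ (πm w)).1.trans (min_le_left _ _)
    rw [abs_le] at this
    constructor <;> simp only [hb] <;> linarith [this.1, this.2]
  have cm : ∀ w, -(c w) ∈ Icc (-σ - β2) (-σ + β2) := by
    intro w
    have := (hBC _ (πm w)).2.1.trans (min_le_right _ _)
    rw [abs_le] at this
    constructor <;> simp only [hc] <;> linarith [this.1, this.2]
  set P : ℝ × ℝ → ℝ × ℝ × ℝ := fun w => (sx (π w).1 (b w), sy (π w).1 (b w), 0) with hP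
  have Pc : Continuous P :=
    (D1.csx.comp (πc.fst.prodMk bc)).prodMk ((csy.comp (πc.fst.prodMk bc)).prodMk continuous_const)
  set O : ℝ × ℝ → ℝ → ℝ × ℝ × ℝ := fun w t => Φ t (P w) with hO
  have Osol : ∀ w, Sol (Cl f ρ) (Cl g ρ) ε (fun t => (O w t).1) (fun t => (O w t).2.1)
      (fun t => (O w t).2.2) := fun w => Φsol (P w)
  have O0 : ∀ w, O w 0 = P w := fun w => Φ0 _
  have Oc : ∀ {k : (ℝ × ℝ) × ℝ → ℝ}, Continuous k →
      Continuous fun q : (ℝ × ℝ) × ℝ => O q.1 (k q) := by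
    intro k hk
    exact Φc.comp (hk.prodMk (Pc.comp continuous_fst))
  have Oc' : ∀ {k : (ℝ × ℝ) → ℝ}, Continuous k → Continuous fun w : ℝ × ℝ => O w (k w) := by
    intro k hk
    exact Φc.comp (hk.prodMk Pc)
  -- the two halves
  have C1 : ∀ w, Concl δ K1 (|K1| + |K2| + 1) (sx 0 τ) a1 b1 (π w).1 (b w)
      (fun t => (O w (t + -(b w))).1) (fun t => (O w (t + -(b w))).2.1)
      (fun t => (O w (t + -(b w))).2.2) := by
    intro w
    refine H1 ε hε hεε1 _ (prm _) _ (bm w) _ _ _ (sol_shift (Osol w) (-(b w))) ?_ ?_ ?_ <;>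
    first | (simp only [add_neg_cancel, O0, hP]; done) | (simp only [add_neg_cancel, O0, hP]; rfl)
  have C2 : ∀ w, Concl δ K2 (|K1| + |K2| + 1) (sx2 0 (-σ)) a2 b2 (π w).2 (-(c w))
      (fun t => (O w (-t + -(c w))).1) (fun t => -(O w (-t + -(c w))).2.1)
      (fun t => -(O w (-t + -(c w))).2.2) := by
    intro w
    obtain ⟨-, -, q1, q2⟩ := hBC _ (πm w)
    refine H2 ε hε hεε2 _ (prm _) _ (cm w) _ _ _
      (sol_refl hρ.le (sol_shift (Osol w) (-(c w)))) ?_ ?_ ?_ <;>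
    simp only [neg_neg, add_neg_cancel, O0, hP]
    · exact q1
    · simp only [hb, hc]
      rw [q2, neg_neg]
    · simp
  obtain ⟨T1, T1c, hT1⟩ := hitting (Y := fun w t => (O w (t + -(b w))).2.1) (a := a1) (b := b1)
    ((Oc (continuous_snd.add (bc.comp continuous_fst).neg)).snd.fst) (by linarith)
    (fun w => (C1 w).mono) (fun w => (C1 w).ya) (fun w => (C1 w).yb)
  obtain ⟨T2, T2c, hT2⟩ := hitting (Y := fun w t => -(O w (-t + -(c w))).2.1) (a := a2) (b := b2)
    ((Oc (continuous_snd.neg.add (cc.comp continuous_fst).neg)).snd.fst.neg) (by linarith)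
    (fun w => (C2 w).mono) (fun w => (C2 w).ya) (fun w => (C2 w).yb)
  have E1c := Oc' (T1c.add bc.neg)
  have E2c := Oc' (T2c.neg.add cc.neg)
  have hK1 := neg_abs_le K1
  have hK2 := neg_abs_le K2
  have hK1' := le_abs_self K1
  have hK2' := le_abs_self K2
  have hK1n := abs_nonneg K1
  have hK2n := abs_nonneg K2
  have hdd : δ ∈ Icc (-δ) δ := ⟨by linarith, le_rfl⟩
  have hmd : -δ ∈ Icc (-δ) δ := ⟨le_rfl, by linarith⟩
  obtain ⟨w, w1, w2⟩ := exists_zero_square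
    (fun w => (O w (T1 w + -(b w))).1 - (O w (-(T2 w) + -(c w))).1)
    (fun w => (O w (T1 w + -(b w))).2.2 + -(O w (-(T2 w) + -(c w))).2.2)
    (E1c.fst.sub E2c.fst) (E1c.snd.snd.add E2c.snd.snd.neg) hδ
    (by
      intro v hv
      have e1 := (C1 (δ, v)).B _ (hT1 _).1 (hT1 _).2 (pre _ hdd)
      have e2 := (C2 (δ, v)).low _ (hT2 _).1 (hT2 _).2
      try simp only at e1 e2 ⊢
      linarith)
    (by
      intro u hu
      have e1 := (C2 (u, δ)).B _ (hT2 _).1 (hT2 _).2 (pre _ hdd)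
      have e2 := (C1 (u, δ)).low _ (hT1 _).1 (hT1 _).2
      try simp only at e1 e2 ⊢
      linarith)
    (by
      intro u hu h0
      have e1 := (C2 (u, -δ)).A' _ (hT2 _).1 (hT2 _).2 (pre _ hmd)
      have e2 := (C2 (u, -δ)).A _ (hT2 _).1 (hT2 _).2 (by
        have : (π (u, -δ)).2 = -δ := pre _ hmd
        linarith)
      have e3 := (C1 (u, -δ)).C _ (hT1 _).1 (hT1 _).2
      have e4 := (C1 (u, -δ)).A _ (hT1 _).1 (hT1 _).2
      try simp only at e1 e2 e3 e4 h0 ⊢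
      rcases le_total (-δ / 2) (π (u, -δ)).1 with h | h
      · linarith [e3 h]
      · linarith [e4 h])
    (by
      intro v hv h0
      have e1 := (C1 (-δ, v)).A' _ (hT1 _).1 (hT1 _).2 (pre _ hmd)
      have e2 := (C1 (-δ, v)).A _ (hT1 _).1 (hT1 _).2 (by
        have : (π (-δ, v)).1 = -δ := pre _ hmd
        linarith)
      have e3 := (C2 (-δ, v)).C _ (hT2 _).1 (hT2 _).2
      have e4 := (C2 (-δ, v)).A _ (hT2 _).1 (hT2 _).2
      try simp only at e1 e2 e3 e4 h0 ⊢
      rcases le_total (-δ / 2) (π (-δ, v)).2 with h | h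
      · linarith [e3 h]
      · linarith [e4 h])
    (by
      have e1 := (C2 (δ, -δ)).A' _ (hT2 _).1 (hT2 _).2 (pre _ hmd)
      have e3 := (C1 (δ, -δ)).C _ (hT1 _).1 (hT1 _).2 (by
        have : (π (δ, -δ)).1 = δ := pre _ hdd
        linarith)
      try simp only at e1 e3 ⊢
      linarith)
    (by
      have e1 := (C1 (-δ, δ)).A' _ (hT1 _).1 (hT1 _).2 (pre _ hmd)
      have e3 := (C2 (-δ, δ)).C _ (hT2 _).1 (hT2 _).2 (by
        have : (π (-δ, δ)).2 = δ := pre _ hdd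
        linarith)
      try simp only at e1 e3 ⊢
      linarith)
  -- the periodic orbit
  have hy1 := (hT1 w).2
  have hy2 := (hT2 w).2
  have hT1m := (hT1 w).1
  have hT2m := (hT2 w).1
  try simp only at w1 w2 hy1 hy2
  set t1 := T1 w + -(b w) with ht1
  set t2 := -(T2 w) + -(c w) with ht2
  have ht1pos : 0 < t1 := by linarith [hT1m.1, (bm w).2]
  have ht2neg : t2 < 0 := by linarith [hT2m.1, (cm w).2]
  set T := t1 - t2 with hTdef
  have hTpos : 0 < T := by linarith
  have hper : ∀ t, (O w (t + T)).1 = (O w t).1 ∧ (O w (t + T)).2.1 = (O w t).2.1 ∧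
      (O w (t + T)).2.2 = (O w t).2.2 := by
    intro t
    have e : t2 + T = t1 := by rw [hTdef]; ring
    exact full_unique hL hε niceC (sol_shift (Osol w) T) (Osol w) (s := t2)
      (by simp only [e]; linarith) (by simp only [e]; linarith) (by simp only [e]; linarith) t
  have hcl : ∀ t, |(O w t).2.2| ≤ |(O w t).1| + ρ :=
    clamp_both hε hTpos hMρ (speed (Osol w).1 (fun t => (niceC.1 _ _ _).1)) (Osol w).2.2
      (fun t => (hper t).1) (fun t => (hper t).2.2)
  have hx0 : (O w 0).1 ≤ sx 0 τ / 2 := by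
    rw [O0]
    exact hxs1 _ ((abs_le.2 (prm _)).trans hδδ1) _ (bm w)
  have hz0 : (O w 0).2.2 = 0 := by rw [O0]
  refine ⟨fun t => (O w t).1, fun t => (O w t).2.1, fun t => (O w t).2.2, T,
    ⟨fun t => ?_, fun t => ?_, (Osol w).2.2, ?_, hTpos, hper, ?_⟩, ?_⟩
  · have := (Osol w).1 t
    rwa [Cl, clp_eq (hcl t)] at this
  · have := (Osol w).2.1 t
    rwa [Cl, clp_eq (hcl t)] at this
  · refine ⟨-a1 + -(b w), b1 + -(b w), fun h => ?_⟩
    have e1 := (C1 w).ya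
    have e2 := (C1 w).yb
    have e3 := h.2.1
    try simp only at e1 e2 e3
    linarith
  · intro T' hT' hp
    by_contra hlt
    push Not at hlt
    have p1 := (hp 0).1
    have p3 := (hp 0).2.2
    simp only [zero_add] at p1 p3
    rcases le_or_gt T' t1 with h | h
    · have := (C1 w).ret _ hT1m hy1 (T' + b w) ⟨by linarith, by linarith⟩
      simp only [add_neg_cancel_right] at this
      have := this (by rw [p3, hz0])
      linarith
    · have q1 := (hper (T' - T)).1
      have q3 := (hper (T' - T)).2.2
      rw [sub_add_cancel] at q1 q3
      have := (C2 w).ret _ hT2m hy2 (-(T' - T) - c w) ⟨by linarith, by linarith⟩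
      have e : -(-(T' - T) - c w) + -(c w) = T' - T := by ring
      simp only [e] at this
      have := this (by rw [← q3, p3, hz0, neg_zero])
      rw [hxs] at this
      linarith
  · have i1 := (hBC _ (πm w)).1.trans ((min_le_left _ _).trans hβη1)
    have i2 := (hBC _ (πm w)).2.1.trans ((min_le_right _ _).trans hβη2)
    rw [abs_le] at i1 i2
    have eT : T - (σ - τ) = T1 w + T2 w - B (π w) + C (π w) := by
      simp only [hTdef, ht1, ht2, hb, hc]; ring
    rw [eT, abs_le]
    constructor <;> linarith [hT1m.1, hT1m.2, hT2m.1, hT2m.2, i1.1, i1.2, i2.1, i2.2]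

end Canard
end


open Set Filter Topology

namespace Canard

lemma cont_lip3 {F : ℝ → ℝ → ℝ → ℝ} {L : ℝ}
    (h : ∀ x₁ y₁ z₁ x₂ y₂ z₂, |F x₁ y₁ z₁ - F x₂ y₂ z₂| ≤ L * (|x₁ - x₂| + |y₁ - y₂| + |z₁ - z₂|))
    {a b c : ℝ × ℝ → ℝ} (ha : Continuous a) (hb : Continuous b) (hc : Continuous c) :
    Continuous fun w => F (a w) (b w) (c w) := by
  rw [continuous_iff_continuousAt]
  intro w
  rw [ContinuousAt, tendsto_iff_norm_sub_tendsto_zero]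
  have hz : Tendsto (fun v => L * (|a v - a w| + |b v - b w| + |c v - c w|)) (𝓝 w) (𝓝 0) := by
    have : Continuous fun v => L * (|a v - a w| + |b v - b w| + |c v - c w|) := by fun_prop
    have := this.tendsto w
    simpa using this
  exact squeeze_zero (fun v => norm_nonneg _) (fun v => h _ _ _ _ _ _) hz

lemma choice_final {f g : ℝ → ℝ → ℝ → ℝ} {P : ℝ}
    (H : ∀ η > 0, ∃ ε0 > 0, ∀ ε, 0 < ε → ε < ε0 → ∃ x y z : ℝ → ℝ, ∃ T : ℝ, Per f g ε x y z T ∧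
      |T - P| ≤ 4 * η) :
    ∃ ε₀ > (0 : ℝ), ∃ Tmin : ℝ → ℝ,
      (∀ ε : ℝ, 0 < ε → ε < ε₀ → ∃ x y z : ℝ → ℝ, Per f g ε x y z (Tmin ε)) ∧
      (∀ η > (0 : ℝ), ∃ ε₁ > (0 : ℝ), ∀ ε : ℝ, 0 < ε → ε < ε₁ → ε < ε₀ → |Tmin ε - P| ≤ η) := by
  obtain ⟨ε0, hε0, H0⟩ := H 1 one_pos
  have key : ∀ ε : ℝ, ∃ T : ℝ, 0 < ε → ε < ε0 → (∃ x y z : ℝ → ℝ, Per f g ε x y z T) ∧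
      ∀ T', (∃ x y z : ℝ → ℝ, Per f g ε x y z T') → |T - P| ≤ |T' - P| + ε := by
    intro ε
    by_cases h : 0 < ε ∧ ε < ε0
    · obtain ⟨h1, h2⟩ := h
      set S : Set ℝ := {d | ∃ T, (∃ x y z : ℝ → ℝ, Per f g ε x y z T) ∧ d = |T - P|} with hS
      obtain ⟨x, y, z, T, hT, -⟩ := H0 ε h1 h2
      have hne : S.Nonempty := ⟨_, T, ⟨x, y, z, hT⟩, rfl⟩
      have hbd : BddBelow S := ⟨0, by rintro d ⟨T, -, rfl⟩; exact abs_nonneg _⟩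
      obtain ⟨d, ⟨T1, hT1, rfl⟩, hd⟩ := exists_lt_of_csInf_lt hne (lt_add_of_pos_right (sInf S) h1)
      refine ⟨T1, fun _ _ => ⟨hT1, fun T' hT' => ?_⟩⟩
      have := csInf_le hbd (show |T' - P| ∈ S from ⟨T', hT', rfl⟩)
      linarith
    · exact ⟨0, fun h1 h2 => absurd ⟨h1, h2⟩ h⟩
  choose Tmin hT using key
  refine ⟨ε0, hε0, Tmin, fun ε h1 h2 => (hT ε h1 h2).1, fun η hη => ?_⟩
  obtain ⟨e, he, He⟩ := H (η / 8) (by positivity)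
  refine ⟨min e (η / 2), lt_min he (by positivity), fun ε h1 h2 h3 => ?_⟩
  obtain ⟨x, y, z, T, hPer, hd⟩ := He ε h1 (h2.trans_le (min_le_left _ _))
  have a1 := (hT ε h1 h3).2 T ⟨x, y, z, hPer⟩
  have a2 := h2.trans_le (min_le_right _ _)
  linarith

end Canard

open Canard
theorem periodic_canard_exists
    (M lam : ℝ) (hM : 0 < M) (hlam : 0 ≤ lam)
    (f g : ℝ → ℝ → ℝ → ℝ)
    -- Assumption 1: global boundedness and global Lipschitz continuity
    (hbound : ∀ x y z : ℝ, |f x y z| < M ∧ |g x y z| < M)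
    (hLipf : ∀ x₁ y₁ z₁ x₂ y₂ z₂ : ℝ,
      |f x₁ y₁ z₁ - f x₂ y₂ z₂| ≤ lam * (|x₁ - x₂| + |y₁ - y₂| + |z₁ - z₂|))
    (hLipg : ∀ x₁ y₁ z₁ x₂ y₂ z₂ : ℝ,
      |g x₁ y₁ z₁ - g x₂ y₂ z₂| ≤ lam * (|x₁ - x₂| + |y₁ - y₂| + |z₁ - z₂|))
    -- Assumption 2
    (hf000 : f 0 0 0 = 0) (hg000 : 0 < g 0 0 0)
    (hyf : ∀ y : ℝ, y ≠ 0 → y * f 0 y 0 < 0)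
    -- the solutions w*_a, w*_r of the attractive/repulsive reduced systems with
    -- initial condition x(0) = y(0) = 0
    (xa ya xr yr : ℝ → ℝ)
    (hxa : ∀ t : ℝ, HasDerivAt xa (f (xa t) (ya t) (xa t)) t)
    (hya : ∀ t : ℝ, HasDerivAt ya (g (xa t) (ya t) (xa t)) t)
    (hxr : ∀ t : ℝ, HasDerivAt xr (f (xr t) (yr t) (-(xr t))) t)
    (hyr : ∀ t : ℝ, HasDerivAt yr (g (xr t) (yr t) (-(xr t))) t)
    (hxa0 : xa 0 = 0) (hya0 : ya 0 = 0) (hxr0 : xr 0 = 0) (hyr0 : yr 0 = 0)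
    (Ta Tr : ℝ) (hTa : Ta < 0) (hTr : 0 < Tr)
    (hxaneg : ∀ t : ℝ, Ta < t → t < 0 → xa t < 0)
    (hxrneg : ∀ t : ℝ, 0 < t → t < Tr → xr t < 0)
    -- Assumption 3: transversal intersection point (x*, y*)
    (τ σ xs ys : ℝ) (hτ₁ : Ta < τ) (hτ₂ : τ < 0) (hσ₁ : 0 < σ) (hσ₂ : σ < Tr)
    (hxaτ : xa τ = xs) (hxrσ : xr σ = xs) (hyaτ : ya τ = ys) (hyrσ : yr σ = ys)
    -- Assumption 4: transversality A ≠ 0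
    (hA : f xs ys xs * g xs ys (-xs) - f xs ys (-xs) * g xs ys xs ≠ 0) :
    ∃ ε₀ > (0 : ℝ), ∃ Tmin : ℝ → ℝ,
      (∀ ε : ℝ, 0 < ε → ε < ε₀ → ∃ x y z : ℝ → ℝ,
        -- (x, y, z) is a solution of the slow–fast system on ℝ
        (∀ t : ℝ, HasDerivAt x (f (x t) (y t) (z t)) t) ∧
        (∀ t : ℝ, HasDerivAt y (g (x t) (y t) (z t)) t) ∧
        (∀ t : ℝ, HasDerivAt z ((x t + |z t|) / ε) t) ∧
        -- non-constant
        (∃ s t : ℝ, ¬ (x s = x t ∧ y s = y t ∧ z s = z t)) ∧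
        -- Tmin ε is a positive period
        0 < Tmin ε ∧
        (∀ t : ℝ, x (t + Tmin ε) = x t ∧ y (t + Tmin ε) = y t ∧ z (t + Tmin ε) = z t) ∧
        -- Tmin ε is the minimal period
        (∀ T' : ℝ, 0 < T' →
          (∀ t : ℝ, x (t + T') = x t ∧ y (t + T') = y t ∧ z (t + T') = z t) →
          Tmin ε ≤ T')) ∧
      -- the minimal periods tend to σ - τ as ε → 0
      (∀ η > (0 : ℝ), ∃ ε₁ > (0 : ℝ), ∀ ε : ℝ, 0 < ε → ε < ε₁ → ε < ε₀ →
        |Tmin ε - (σ - τ)| ≤ η) := by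
  have hN : Nice f g M lam :=
    ⟨fun x y z => ⟨(hbound x y z).1.le, (hbound x y z).2.le⟩, hLipf, hLipg⟩
  have hN2 := nice_refl hN
  obtain ⟨sx, sy, slow, sx0, sy0, csx, csy⟩ := slow_flow hlam hN
  obtain ⟨sx2, sy2, slow2, sx20, sy20, csx2, csy2⟩ := slow_flow hlam hN2
  have id1 : ∀ t, sx 0 t = xa t ∧ sy 0 t = ya t :=
    slow_unique hlam hN (slow 0) ⟨hxa, hya⟩ (s := 0) (by rw [sx0, hxa0]) (by rw [sy0, hya0])
  have id2 : ∀ t, sx2 0 t = xr (-t) ∧ sy2 0 t = -yr (-t) := by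
    refine slow_unique hlam hN2 (slow2 0) (x' := fun t => xr (-t)) (y' := fun t => -yr (-t))
      ⟨fun t => ?_, fun t => ?_⟩ (s := 0) ?_ ?_
    · have := (hxr (-t)).comp t (hasDerivAt_neg t)
      refine this.congr_deriv ?_
      simp only [rf, neg_neg]; ring
    · have := ((hyr (-t)).comp t (hasDerivAt_neg t)).neg
      refine this.congr_deriv ?_
      simp only [rg, neg_neg]; ring
    · simp [sx20, hxr0]
    · simp [sy20, hyr0]
  have D1 : Data f g M lam Ta τ sx sy :=
    ⟨hM, hlam, hN, hg000, hyf, slow, sx0, sy0, csx, hτ₁, hτ₂,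
      fun t h1 h2 => by rw [(id1 t).1]; exact hxaneg t h1 h2⟩
  have D2 : Data (rf f) (rg g) M lam (-Tr) (-σ) sx2 sy2 := by
    refine ⟨hM, hlam, hN2, ?_, fun y hy => ?_, slow2, sx20, sy20, csx2, by linarith, by linarith,
      fun t h1 h2 => ?_⟩
    · simpa [rg] using hg000
    · have := hyf (-y) (neg_ne_zero.2 hy)
      simp only [rf, neg_zero]
      linarith
    · rw [(id2 t).1]; exact hxrneg _ (by linarith) (by linarith)
  have vx2 : sx2 0 (-σ) = xs := by rw [(id2 _).1, neg_neg, hxrσ]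
  have vy2 : sy2 0 (-σ) = -ys := by rw [(id2 _).2, neg_neg, hyrσ]
  have vx1 : sx 0 τ = xs := by rw [(id1 _).1, hxaτ]
  have vy1 : sy 0 τ = ys := by rw [(id1 _).2, hyaτ]
  have crx : Continuous fun w : ℝ × ℝ => sx2 w.1 (-w.2) :=
    csx2.comp (continuous_fst.prodMk continuous_snd.neg)
  have cry : Continuous fun w : ℝ × ℝ => sy2 w.1 (-w.2) :=
    csy2.comp (continuous_fst.prodMk continuous_snd.neg)
  have H := fun (η : ℝ) (hη : η > 0) => match_eta D1 D2 csy (by rw [vx1, vx2]) (fun β hβ =>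
    implicit (ax := sx) (ay := sy) (rx := fun v t => sx2 v (-t)) (ry := fun v t => -sy2 v (-t))
      (ax' := fun u t => f (sx u t) (sy u t) (sx u t))
      (ay' := fun u t => g (sx u t) (sy u t) (sx u t))
      (rx' := fun v t => -rf f (sx2 v (-t)) (sy2 v (-t)) (sx2 v (-t)))
      (ry' := fun v t => rg g (sx2 v (-t)) (sy2 v (-t)) (sx2 v (-t)))
      (τ := τ) (σ := σ) csx csy crx cry.neg
      (cont_lip3 hN.2.1 csx csy csx) (cont_lip3 hN.2.2 csx csy csx)
      (cont_lip3 hN2.2.1 crx cry crx).neg (cont_lip3 hN2.2.2 crx cry crx)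
      (fun u => (slow u).1) (fun u => (slow u).2)
      (fun u t => (((slow2 u).1 (-t)).comp t (hasDerivAt_neg t)).congr_deriv (by ring))
      (fun u t => ((((slow2 u).2 (-t)).comp t (hasDerivAt_neg t)).neg).congr_deriv (by ring))
      (by simp only [vx1, vx2]) (by simp only [vy1, vy2, neg_neg])
      (by simpa only [vx1, vx2, vy1, vy2, rf, rg, neg_neg] using hA) hβ) hη
  exact choice_final H
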